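/- arXiv:2309.01197 — 2 statements merged into one kernel-verified Lean document; each statement's English description precedes it below -/
import Mathlib

section
/- Uniqueness of classical solutions: let v and ṽ be two classical solutions of the Lagrangian system ρ₀∂_t v^i + (ρ₀²J^{−2}a_i^k),_k = (ρ₀J^{−2}b^{kj}v^i,_j),_k on Ω×(0,T] with the same initial data v(·,0) = ṽ(·,0) = u₀, each smooth on Ω̄×[0,T] and each satisfying the a priori assumption (with their respective flow maps, Jacobians and cofactor matrices). Then v = ṽ on Ω×(0,T]. -/
open MeasureTheory Real Filter

noncomputable section

/-- The reference domain `Ω = 𝕋 × (0,1)`, realized as the fundamental square `(0,1) × (0,1)`. -/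
def Oset : Set (ℝ × ℝ) := Set.Ioo (0:ℝ) 1 ×ˢ Set.Ioo (0:ℝ) 1

/-- The vacuum boundary `Γ = 𝕋 × {0,1}`. -/
def Gset : Set (ℝ × ℝ) := {x : ℝ × ℝ | x.2 = 0 ∨ x.2 = 1}

/-- Distance to the boundary `Γ`. -/
def distG (x : ℝ × ℝ) : ℝ := min x.2 (1 - x.2)

variable {F : Type*} [NormedAddCommGroup F] [NormedSpace ℝ F]

/-- Horizontal partial derivative `∂₁`. -/
def pd1 (f : ℝ × ℝ → F) : ℝ × ℝ → F := fun x => fderiv ℝ f x (1, 0)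

/-- Vertical (normal) partial derivative `∂₂`. -/
def pd2 (f : ℝ × ℝ → F) : ℝ × ℝ → F := fun x => fderiv ℝ f x (0, 1)

/-- Time derivative `∂ₜ`. -/
def pdt (v : ℝ → ℝ × ℝ → F) : ℝ → ℝ × ℝ → F := fun t x => deriv (fun s => v s x) t

/-- `|Df|²` at a point. -/
def gradSq (f : ℝ × ℝ → F) (x : ℝ × ℝ) : ℝ := ‖pd1 f x‖ ^ 2 + ‖pd2 f x‖ ^ 2

/-- 1-periodicity in the horizontal variable (functions on the torus `𝕋 × (0,1)`). -/
def Per (f : ℝ × ℝ → F) : Prop := ∀ x : ℝ × ℝ, f (x.1 + 1, x.2) = f x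

/-- Smoothness. -/
def SmoothFn (f : ℝ × ℝ → F) : Prop := ∀ n : ℕ, ContDiff ℝ n f

/-- Joint smoothness of a time dependent family. -/
def SmoothT (v : ℝ → ℝ × ℝ → F) : Prop :=
  ∀ n : ℕ, ContDiff ℝ n (fun p : ℝ × (ℝ × ℝ) => v p.1 p.2)

def PerT (v : ℝ → ℝ × ℝ → F) : Prop := ∀ t : ℝ, Per (v t)

/-- Admissible initial depth profile: smooth, periodic, vanishing on `Γ` and
comparable to the distance to the boundary. -/
def IsDensity (C₁ C₂ : ℝ) (ρ₀ : ℝ × ℝ → ℝ) : Prop :=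
  SmoothFn ρ₀ ∧ Per ρ₀ ∧ (∀ x ∈ Gset, ρ₀ x = 0) ∧
    ∀ x ∈ Oset, C₁ * distG x ≤ ρ₀ x ∧ ρ₀ x ≤ C₂ * distG x

/-- The higher-order energy functional `E(t,v)`. -/
def energy (ρ₀ : ℝ × ℝ → ℝ) (v : ℝ → ℝ × ℝ → ℝ × ℝ) (t : ℝ) : ℝ :=
  (∑ l₀ ∈ Finset.range 5, ∫ x in Oset, ρ₀ x * ‖(pdt^[l₀] v) t x‖ ^ 2)
    + (∑ l₀ ∈ Finset.range 4, ∑ l₁ ∈ Finset.range (7 - 2 * l₀),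
        ∫ x in Oset, ρ₀ x *
          (gradSq (pd1^[l₁] ((pdt^[l₀] v) t)) x + gradSq (pd1^[l₁ + 1] ((pdt^[l₀] v) t)) x))
    + ∑ l₀ ∈ Finset.range 4, ∑ l₁ ∈ Finset.range (7 - 2 * l₀),
        ∑ l₂ ∈ Finset.Icc 2 (8 - 2 * l₀ - l₁),
          ∫ x in Oset, ρ₀ x ^ l₂ * ‖(pd1^[l₁] (pd2^[l₂] ((pdt^[l₀] v) t))) x‖ ^ 2

/-- The Lagrangian flow map `η(x,t) = x + ∫₀ᵗ v(x,s) ds`. -/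
def flowMap (v : ℝ → ℝ × ℝ → ℝ × ℝ) (t : ℝ) (x : ℝ × ℝ) : ℝ × ℝ :=
  x + ∫ s in (0:ℝ)..t, v s x

/-- The (squared-sum) Sobolev `H^k(Ω)` norm. -/
def sobolevNorm (k : ℕ) (f : ℝ × ℝ → F) : ℝ :=
  Real.sqrt (∑ θ ∈ Finset.range (k + 1), ∫ x in Oset, ‖iteratedFDeriv ℝ θ f x‖ ^ 2)

/-- `sup_{0 ≤ s ≤ t} E(s,v)^{1/2}`. -/
def supEn (ρ₀ : ℝ × ℝ → ℝ) (v : ℝ → ℝ × ℝ → ℝ × ℝ) (t : ℝ) : ℝ :=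
  ⨆ s : Set.Icc (0:ℝ) t, Real.sqrt (energy ρ₀ v ↑s)

/-- Weighted `L²(Ω)` norm `‖ρ₀^p ∂₁^{l₁} D^k f‖_{L²(Ω)}`. -/
def wL2 (ρ₀ : ℝ × ℝ → ℝ) (p k l₁ : ℕ) (f : ℝ × ℝ → F) : ℝ :=
  Real.sqrt (∫ x in Oset, (ρ₀ x ^ p * ‖iteratedFDeriv ℝ k (pd1^[l₁] f) x‖) ^ 2)

/-- Weighted `L^∞(Ω)` norm `‖ρ₀^p ∂₁^{l₁} D^k f‖_{L^∞(Ω)}`. -/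
def wSup (ρ₀ : ℝ × ℝ → ℝ) (p k l₁ : ℕ) (f : ℝ × ℝ → F) : ℝ :=
  ⨆ x : Oset, ρ₀ (x : ℝ × ℝ) ^ p * ‖iteratedFDeriv ℝ k (pd1^[l₁] f) (x : ℝ × ℝ)‖

def pick (i : Fin 2) (w : ℝ × ℝ) : ℝ := if i = 0 then w.1 else w.2

def evec (k : Fin 2) : ℝ × ℝ := if k = 0 then (1, 0) else (0, 1)

def pdk (k : Fin 2) (f : ℝ × ℝ → ℝ) : ℝ × ℝ → ℝ := fun x => fderiv ℝ f x (evec k)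

/-- The cofactor matrix `a` of `Dη`, `a = [[∂₂η², −∂₂η¹], [−∂₁η², ∂₁η¹]]`,
indexed so that `cof η x i k = a_i^k`. -/
def cof (η : ℝ × ℝ → ℝ × ℝ) (x : ℝ × ℝ) (i k : Fin 2) : ℝ :=
  if i = 0 then
    (if k = 0 then pd2 (fun y => (η y).2) x else -pd1 (fun y => (η y).2) x)
  else
    (if k = 0 then -pd2 (fun y => (η y).1) x else pd1 (fun y => (η y).1) x)

/-- The Jacobian determinant `J = det Dη`. -/
def jac (η : ℝ × ℝ → ℝ × ℝ) (x : ℝ × ℝ) : ℝ :=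
  pd1 (fun y => (η y).1) x * pd2 (fun y => (η y).2) x
    - pd2 (fun y => (η y).1) x * pd1 (fun y => (η y).2) x

/-- `b^{kj} = a_l^k a_l^j`. -/
def bmat (η : ℝ × ℝ → ℝ × ℝ) (x : ℝ × ℝ) (k j : Fin 2) : ℝ :=
  ∑ l : Fin 2, cof η x l k * cof η x l j

/-- `(v,η)` is a (classical) solution of the Lagrangian system
`ρ₀ ∂ₜ v^i + (ρ₀² J⁻² a_i^k),_k = (ρ₀ J⁻² b^{kj} v^i,_j),_k` in `Ω × (0,T]`. -/
def IsLagSol (ρ₀ : ℝ × ℝ → ℝ) (v : ℝ → ℝ × ℝ → ℝ × ℝ) (T : ℝ) : Prop :=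
  ∀ t : ℝ, 0 < t → t ≤ T → ∀ x ∈ Oset, ∀ i : Fin 2,
    ρ₀ x * pick i (pdt v t x)
        + ∑ k : Fin 2, pdk k
            (fun y => ρ₀ y ^ 2 * jac (flowMap v t) y ^ (-2 : ℤ) * cof (flowMap v t) y i k) x
      = ∑ k : Fin 2, pdk k
          (fun y => ρ₀ y * jac (flowMap v t) y ^ (-2 : ℤ) *
            ∑ j : Fin 2, bmat (flowMap v t) y k j * pdk j (fun z => pick i (v t z)) y) x

/-- The a priori assumption: `sup_{0≤t≤T} E(t,v) ≤ M₁`,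
`T ∈ (0, 1/(20c₁c₂√M₁ + 10c₁²c₂²M₁)] ∩ (0,1)`, where `c₁, c₂` are the constants of the
embedding inequalities, so that in particular `‖Dv‖_{L^∞} ≤ c₁c₂ E^{1/2}`. -/
def Apriori (ρ₀ : ℝ × ℝ → ℝ) (v : ℝ → ℝ × ℝ → ℝ × ℝ) (T M₁ c₁ c₂ : ℝ) : Prop :=
  0 < c₁ ∧ 0 < c₂ ∧ 0 ≤ M₁ ∧ 0 < T ∧ T ≤ 1 ∧
    T ≤ 1 / (20 * c₁ * c₂ * Real.sqrt M₁ + 10 * c₁ ^ 2 * c₂ ^ 2 * M₁) ∧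
    (∀ t ∈ Set.Icc (0:ℝ) T, energy ρ₀ v t ≤ M₁) ∧
    ∀ t ∈ Set.Icc (0:ℝ) T, ∀ x ∈ Oset,
      ‖fderiv ℝ (v t) x‖ ≤ c₁ * c₂ * Real.sqrt (energy ρ₀ v t)

/-- Smooth test functions compactly supported in `Ω`. -/
def CinfTest (φ : ℝ × ℝ → ℝ) : Prop :=
  (∀ n : ℕ, ContDiff ℝ n φ) ∧ HasCompactSupport φ ∧ tsupport φ ⊆ Oset

/-- `g` is the weak directional derivative of `u` in direction `e` on `Ω`. -/
def WeakPD (e : ℝ × ℝ) (u g : ℝ × ℝ → ℝ) : Prop :=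
  ∀ φ : ℝ × ℝ → ℝ, CinfTest φ →
    ∫ x in Oset, u x * fderiv ℝ φ x e = -∫ x in Oset, g x * φ x

/-- Membership in the weighted space `H¹_{ρ₀}(Ω)`, with weak gradient `Dw`. -/
def InH1w (ρ₀ : ℝ × ℝ → ℝ) (w : ℝ × ℝ → ℝ) (Dw : ℝ × ℝ → ℝ × ℝ) : Prop :=
  AEStronglyMeasurable w (volume.restrict Oset) ∧
    AEStronglyMeasurable Dw (volume.restrict Oset) ∧
    IntegrableOn (fun x => ρ₀ x * (w x) ^ 2) Oset ∧
    IntegrableOn (fun x => ρ₀ x * ‖Dw x‖ ^ 2) Oset ∧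
    WeakPD (1, 0) w (fun x => (Dw x).1) ∧ WeakPD (0, 1) w (fun x => (Dw x).2)

/-- The bilinear form `B[w,φ]_μ = ∫_Ω ρ₀ (Dw·Dφ + wφ) dx`. -/
def Bform (ρ₀ : ℝ × ℝ → ℝ) (w : ℝ × ℝ → ℝ) (Dw : ℝ × ℝ → ℝ × ℝ)
    (φ : ℝ × ℝ → ℝ) (Dφ : ℝ × ℝ → ℝ × ℝ) : ℝ :=
  ∫ x in Oset, ρ₀ x * ((Dw x).1 * (Dφ x).1 + (Dw x).2 * (Dφ x).2 + w x * φ x)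

/-- Differentiation under the time integral. -/
lemma hasFDerivAt_time_integral (f : ℝ × (ℝ × ℝ) → ℝ) (hf : ContDiff ℝ 1 f) (t : ℝ) (x : ℝ × ℝ) :
    HasFDerivAt (fun y => ∫ s in (0:ℝ)..t, f (s, y))
      (∫ s in (0:ℝ)..t, (fderiv ℝ f (s, x)).comp (ContinuousLinearMap.inr ℝ ℝ (ℝ × ℝ))) x := by
  have hc : Continuous f := hf.continuous
  have hdc : Continuous (fun p : ℝ × (ℝ × ℝ) =>
      (fderiv ℝ f p).comp (ContinuousLinearMap.inr ℝ ℝ (ℝ × ℝ))) :=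
    (hf.continuous_fderiv (by norm_num)).clm_comp continuous_const
  have hK : IsCompact (Set.uIcc 0 t ×ˢ Metric.closedBall x 1 : Set (ℝ × (ℝ × ℝ))) :=
    isCompact_uIcc.prod (isCompact_closedBall x 1)
  obtain ⟨C, hC⟩ := hK.exists_bound_of_continuousOn hdc.continuousOn
  refine intervalIntegral.hasFDerivAt_integral_of_dominated_of_fderiv_le
    (F := fun y s => f (s, y))
    (F' := fun y s => (fderiv ℝ f (s, y)).comp (ContinuousLinearMap.inr ℝ ℝ (ℝ × ℝ)))
    (bound := fun _ => C) (Metric.ball_mem_nhds x one_pos) ?_ ?_ ?_ ?_ ?_ ?_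
  · exact Eventually.of_forall fun y =>
      (hc.comp (by fun_prop : Continuous fun s : ℝ => (s, y))).aestronglyMeasurable
  · exact (hc.comp (by fun_prop : Continuous fun s : ℝ => (s, x))).intervalIntegrable _ _
  · exact (hdc.comp (by fun_prop : Continuous fun s : ℝ => (s, x))).aestronglyMeasurable
  · refine Eventually.of_forall fun s hs y hy => ?_
    exact hC (s, y) ⟨Set.uIoc_subset_uIcc hs, Metric.ball_subset_closedBall hy⟩
  · exact intervalIntegrable_const
  · refine Eventually.of_forall fun s _ y _ => ?_
    have h1 : HasFDerivAt f (fderiv ℝ f (s, y)) (s, y) :=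
      (hf.differentiable (by norm_num) (s, y)).hasFDerivAt
    exact h1.comp y (hasFDerivAt_prodMk_right s y)

/-- The closed unit square. -/
def Sq : Set (ℝ × ℝ) := Set.Icc (0, 0) (1, 1)

lemma Sq_eq : Sq = Set.Icc (0:ℝ) 1 ×ˢ Set.Icc (0:ℝ) 1 := by
  exact Set.Icc_prod_eq _ _

lemma Sq_compact : IsCompact Sq := isCompact_Icc

lemma Oset_sub_Sq : Oset ⊆ Sq := by
  rw [Sq_eq]; exact Set.prod_mono Set.Ioo_subset_Icc_self Set.Ioo_subset_Icc_self

lemma Sq_eq_closure : Sq = closure Oset := by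
  rw [Sq_eq, Oset, closure_prod_eq, closure_Ioo (by norm_num)]

lemma Oset_open : IsOpen Oset := isOpen_Ioo.prod isOpen_Ioo

lemma Sq_ae : (Oset : Set (ℝ × ℝ)) =ᵐ[volume] Sq := by
  rw [Sq_eq, Oset]
  exact Measure.set_prod_ae_eq Ioo_ae_eq_Icc Ioo_ae_eq_Icc

/-- Differentiation under the space integral. -/
lemma hasDerivAt_space_integral (g g' : ℝ → ℝ × ℝ → ℝ)
    (hg : Continuous fun p : ℝ × (ℝ × ℝ) => g p.1 p.2)
    (hg' : Continuous fun p : ℝ × (ℝ × ℝ) => g' p.1 p.2)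
    (hd : ∀ t x, HasDerivAt (fun s => g s x) (g' t x) t) (t : ℝ) :
    HasDerivAt (fun s => ∫ x in Sq, g s x) (∫ x in Sq, g' t x) t := by
  have hK : IsCompact (Metric.closedBall t 1 ×ˢ Sq : Set (ℝ × (ℝ × ℝ))) :=
    (isCompact_closedBall t 1).prod Sq_compact
  obtain ⟨C, hC⟩ := hK.exists_bound_of_continuousOn hg'.continuousOn
  have hgs : ∀ s, Continuous (g s) := fun s =>
    hg.comp (by fun_prop : Continuous fun x : ℝ × ℝ => (s, x))
  have hgs' : ∀ s, Continuous (g' s) := fun s =>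
    hg'.comp (by fun_prop : Continuous fun x : ℝ × ℝ => (s, x))
  refine (hasDerivAt_integral_of_dominated_loc_of_deriv_le
    (F := g) (F' := g') (bound := fun _ => C) (Metric.ball_mem_nhds t one_pos)
    ?_ ?_ ?_ ?_ ?_ ?_).2
  · exact Eventually.of_forall fun s => (hgs s).aestronglyMeasurable
  · exact (hgs t).continuousOn.integrableOn_compact Sq_compact
  · exact (hgs' t).aestronglyMeasurable
  · refine (ae_restrict_iff' Sq_compact.measurableSet).2 (Eventually.of_forall ?_)
    intro x hx s hs
    exact hC (s, x) ⟨Metric.ball_subset_closedBall hs, hx⟩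
  · exact integrableOn_const Sq_compact.measure_lt_top.ne
  · exact Eventually.of_forall fun x s _ => hd s x

/-- `pick` as a continuous linear map. -/
def pickL (i : Fin 2) : ℝ × ℝ →L[ℝ] ℝ :=
  if i = 0 then ContinuousLinearMap.fst ℝ ℝ ℝ else ContinuousLinearMap.snd ℝ ℝ ℝ

lemma pickL_apply (i : Fin 2) (w : ℝ × ℝ) : pickL i w = pick i w := by
  unfold pickL pick; split_ifs <;> rfl

/-- Components as functions of space-time. -/
def UU (v : ℝ → ℝ × ℝ → ℝ × ℝ) (i : Fin 2) (p : ℝ × (ℝ × ℝ)) : ℝ := pick i (v p.1 p.2)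

lemma UU_contDiff {v : ℝ → ℝ × ℝ → ℝ × ℝ} (hv : SmoothT v) (i : Fin 2) (n : ℕ) :
    ContDiff ℝ n (UU v i) := by
  have : UU v i = fun p => pickL i (v p.1 p.2) := by
    funext p; rw [pickL_apply]; rfl
  rw [this]
  exact (pickL i).contDiff.comp (hv n)

/-- Spatial derivative `∂_j v^i`. -/
def BB (v : ℝ → ℝ × ℝ → ℝ × ℝ) (i j : Fin 2) (t : ℝ) (x : ℝ × ℝ) : ℝ :=
  pdk j (fun z => pick i (v t z)) x

lemma UU_slice {v : ℝ → ℝ × ℝ → ℝ × ℝ} (hv : SmoothT v) (i : Fin 2) (t : ℝ) (x : ℝ × ℝ) :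
    HasFDerivAt (fun z => pick i (v t z))
      ((fderiv ℝ (UU v i) (t, x)).comp (ContinuousLinearMap.inr ℝ ℝ (ℝ × ℝ))) x := by
  have h1 : HasFDerivAt (UU v i) (fderiv ℝ (UU v i) (t, x)) (t, x) :=
    ((UU_contDiff hv i 1).differentiable (by norm_num) (t, x)).hasFDerivAt
  exact h1.comp x (hasFDerivAt_prodMk_right t x)

lemma BB_eq {v : ℝ → ℝ × ℝ → ℝ × ℝ} (hv : SmoothT v) (i j : Fin 2) (t : ℝ) (x : ℝ × ℝ) :
    BB v i j t x = fderiv ℝ (UU v i) (t, x) (0, evec j) := by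
  unfold BB pdk
  rw [(UU_slice hv i t x).fderiv]; rfl

lemma BB_contDiff {v : ℝ → ℝ × ℝ → ℝ × ℝ} (hv : SmoothT v) (i j : Fin 2) :
    ContDiff ℝ 1 (fun p : ℝ × (ℝ × ℝ) => BB v i j p.1 p.2) := by
  have : (fun p : ℝ × (ℝ × ℝ) => BB v i j p.1 p.2) =
      fun p => fderiv ℝ (UU v i) p (0, evec j) := by
    funext p; rw [BB_eq hv]
  rw [this]
  exact ((UU_contDiff hv i 2).fderiv_right (m := 1) (by norm_num)).clm_apply contDiff_const

/-- The flow gradient `∂_j η^i`. -/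
def AA (v : ℝ → ℝ × ℝ → ℝ × ℝ) (i j : Fin 2) (t : ℝ) (x : ℝ × ℝ) : ℝ :=
  pick i (evec j) + ∫ s in (0:ℝ)..t, BB v i j s x

lemma AA_cont {v : ℝ → ℝ × ℝ → ℝ × ℝ} (hv : SmoothT v) (i j : Fin 2) :
    Continuous (fun p : ℝ × (ℝ × ℝ) => AA v i j p.1 p.2) := by
  unfold AA
  refine continuous_const.add ?_
  refine intervalIntegral.continuous_parametric_intervalIntegral_of_continuous
    (f := fun (p : ℝ × (ℝ × ℝ)) s => BB v i j s p.2) (s := fun p : ℝ × (ℝ × ℝ) => p.1)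
    ?_ continuous_fst
  exact (BB_contDiff hv i j).continuous.comp
    (by fun_prop : Continuous fun q : (ℝ × (ℝ × ℝ)) × ℝ => (q.2, q.1.2))

lemma AA_deriv {v : ℝ → ℝ × ℝ → ℝ × ℝ} (hv : SmoothT v) (i j : Fin 2) (t : ℝ) (x : ℝ × ℝ) :
    HasDerivAt (fun s => AA v i j s x) (BB v i j t x) t := by
  have hc : Continuous fun s => BB v i j s x :=
    (BB_contDiff hv i j).continuous.comp (by fun_prop : Continuous fun s : ℝ => (s, x))
  exact (hc.integral_hasStrictDerivAt 0 t).hasDerivAt.const_add _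

lemma AA_diff {v : ℝ → ℝ × ℝ → ℝ × ℝ} (hv : SmoothT v) (i j : Fin 2) (t : ℝ) :
    Differentiable ℝ (AA v i j t) := by
  intro x
  exact ((hasFDerivAt_time_integral (fun p => BB v i j p.1 p.2)
    (BB_contDiff hv i j) t x).differentiableAt).const_add _

lemma flow_pd {v : ℝ → ℝ × ℝ → ℝ × ℝ} (hv : SmoothT v) (i j : Fin 2) (t : ℝ) (x : ℝ × ℝ) :
    pdk j (fun y => pick i (flowMap v t y)) x = AA v i j t x := by
  have hc : Continuous fun p : ℝ × (ℝ × ℝ) => v p.1 p.2 := (hv 0).continuous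
  have e : (fun y => pick i (flowMap v t y)) =
      fun y => pickL i y + ∫ s in (0:ℝ)..t, UU v i (s, y) := by
    funext y
    rw [← pickL_apply, flowMap, map_add]
    congr 1
    rw [← ContinuousLinearMap.intervalIntegral_comp_comm]
    · simp only [pickL_apply]; rfl
    · exact (hc.comp (by fun_prop : Continuous fun s : ℝ => (s, y))).intervalIntegrable _ _
  have hd := (pickL i).hasFDerivAt (x := x)|>.add
    (hasFDerivAt_time_integral (UU v i) (UU_contDiff hv i 1) t x)
  unfold pdk
  rw [e]
  erw [hd.fderiv]
  rw [_root_.add_apply, pickL_apply, AA]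
  congr 1
  rw [ContinuousLinearMap.intervalIntegral_apply]
  · refine intervalIntegral.integral_congr fun s _ => ?_
    simp only [BB_eq hv]; rfl
  · have hdc : Continuous (fun p : ℝ × (ℝ × ℝ) =>
      (fderiv ℝ (UU v i) p).comp (ContinuousLinearMap.inr ℝ ℝ (ℝ × ℝ))) :=
      ((UU_contDiff hv i 1).continuous_fderiv (by norm_num)).clm_comp continuous_const
    exact (hdc.comp (by fun_prop : Continuous fun s : ℝ => (s, x))).intervalIntegrable _ _

lemma BB_per {v : ℝ → ℝ × ℝ → ℝ × ℝ} (hp : PerT v) (i j : Fin 2) (t : ℝ) (x : ℝ × ℝ) :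
    BB v i j t (x.1 + 1, x.2) = BB v i j t x := by
  unfold BB pdk
  have e : (fun z => pick i (v t z)) = fun z => (fun z => pick i (v t z)) (z + (1, 0)) := by
    funext z
    have := hp t z
    simp only
    rw [← this]
    congr 2
    ext <;> simp
  conv_rhs => rw [e, fderiv_comp_add_right (f := fun z => pick i (v t z))]
  have e2 : ((x.1 + 1, x.2) : ℝ × ℝ) = x + (1, 0) := by ext <;> simp
  rw [e2]

lemma AA_per {v : ℝ → ℝ × ℝ → ℝ × ℝ} (hp : PerT v) (i j : Fin 2) (t : ℝ) (x : ℝ × ℝ) :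
    AA v i j t (x.1 + 1, x.2) = AA v i j t x := by
  unfold AA
  simp only [BB_per hp]

lemma BB_bound {v : ℝ → ℝ × ℝ → ℝ × ℝ} (hv : SmoothT v) (i j : Fin 2) (t : ℝ) (x : ℝ × ℝ) :
    |BB v i j t x| ≤ ‖fderiv ℝ (v t) x‖ := by
  have hdv : DifferentiableAt ℝ (v t) x := by
    have : ContDiff ℝ 1 (v t) := (hv 1).comp
      (contDiff_prodMk_right t)
    exact this.differentiable (by norm_num) x
  have h1 : HasFDerivAt (fun z => pick i (v t z)) ((pickL i).comp (fderiv ℝ (v t) x)) x := by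
    have := (pickL i).hasFDerivAt.comp x hdv.hasFDerivAt
    refine this.congr_of_eventuallyEq (Eventually.of_forall fun z => ?_)
    simp [pickL_apply]
  unfold BB pdk
  rw [h1.fderiv, ContinuousLinearMap.comp_apply, pickL_apply]
  have h2 : ∀ w : ℝ × ℝ, |pick i w| ≤ ‖w‖ := by
    intro w; unfold pick; split_ifs
    · exact norm_fst_le w
    · exact norm_snd_le w
  have h3 : ‖evec j‖ ≤ 1 := by
    unfold evec; split_ifs <;> simp [Prod.norm_def]
  calc _ ≤ ‖fderiv ℝ (v t) x (evec j)‖ := h2 _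
    _ ≤ ‖fderiv ℝ (v t) x‖ * ‖evec j‖ := ContinuousLinearMap.le_opNorm _ _
    _ ≤ _ := mul_le_of_le_one_right (norm_nonneg _) h3

lemma AA_close {ρ₀ : ℝ × ℝ → ℝ} {v : ℝ → ℝ × ℝ → ℝ × ℝ} {T M₁ c₁ c₂ : ℝ}
    (hv : SmoothT v) (hap : Apriori ρ₀ v T M₁ c₁ c₂) (i j : Fin 2) (t : ℝ)
    (ht : t ∈ Set.Icc 0 T) (x : ℝ × ℝ) (hx : x ∈ Sq) :
    |AA v i j t x - pick i (evec j)| ≤ 1 / 20 := by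
  obtain ⟨h1, h2, hM, hT, -, hTb, hE, hD⟩ := hap
  have hpos : 0 < 20 * c₁ * c₂ * √M₁ + 10 * c₁ ^ 2 * c₂ ^ 2 * M₁ := by
    by_contra hcon
    have hz : 20 * c₁ * c₂ * √M₁ + 10 * c₁ ^ 2 * c₂ ^ 2 * M₁ = 0 :=
      le_antisymm (not_lt.1 hcon) (by positivity)
    rw [hz] at hTb
    norm_num at hTb
    linarith
  have hTb' : T * (c₁ * c₂ * √M₁) ≤ 1 / 20 := by
    rw [le_div_iff₀ hpos] at hTb
    have : 0 ≤ T * (10 * c₁ ^ 2 * c₂ ^ 2 * M₁) := by positivity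
    nlinarith
  have key : ∀ x ∈ Oset, |AA v i j t x - pick i (evec j)| ≤ 1 / 20 := by
    intro x hx
    have : |∫ s in (0:ℝ)..t, BB v i j s x| ≤ (c₁ * c₂ * √M₁) * |t - 0| := by
      refine intervalIntegral.norm_integral_le_of_norm_le_const (f := fun s => BB v i j s x) ?_
      intro s hs
      rw [Set.uIoc_of_le ht.1] at hs
      have hs' : s ∈ Set.Icc 0 T := ⟨hs.1.le, hs.2.trans ht.2⟩
      calc |BB v i j s x| ≤ ‖fderiv ℝ (v s) x‖ := BB_bound hv i j s x
        _ ≤ c₁ * c₂ * √(energy ρ₀ v s) := hD s hs' x hx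
        _ ≤ _ := by
          have := Real.sqrt_le_sqrt (hE s hs')
          gcongr
    rw [sub_zero, abs_of_nonneg ht.1] at this
    unfold AA
    rw [add_sub_cancel_left]
    refine this.trans ?_
    have : (c₁ * c₂ * √M₁) * t ≤ (c₁ * c₂ * √M₁) * T :=
      mul_le_mul_of_nonneg_left ht.2 (by positivity)
    linarith
  have hcl : IsClosed {x | |AA v i j t x - pick i (evec j)| ≤ 1 / 20} := by
    refine isClosed_le ?_ continuous_const
    exact (((AA_diff hv i j t).continuous).sub continuous_const).abs
  rw [Sq_eq_closure] at hx
  exact closure_minimal key hcl hx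

/-- Jacobian of a `2 × 2` matrix. -/
def Jm (A : Fin 2 → Fin 2 → ℝ) : ℝ := A 0 0 * A 1 1 - A 0 1 * A 1 0

/-- Cofactors of a `2 × 2` matrix. -/
def cofm (A : Fin 2 → Fin 2 → ℝ) (i k : Fin 2) : ℝ :=
  if i = 0 then (if k = 0 then A 1 1 else -A 1 0) else (if k = 0 then -A 0 1 else A 0 0)

/-- Viscous flux. -/
def SV (i k : Fin 2) (X : (Fin 2 → Fin 2 → ℝ) × (Fin 2 → Fin 2 → ℝ) × ℝ) : ℝ :=
  (Jm X.1 ^ 2)⁻¹ * ∑ j : Fin 2, (∑ l : Fin 2, cofm X.1 l k * cofm X.1 l j) * X.2.1 i j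

/-- Pressure flux. -/
def SP (i k : Fin 2) (X : (Fin 2 → Fin 2 → ℝ) × (Fin 2 → Fin 2 → ℝ) × ℝ) : ℝ :=
  X.2.2 * (Jm X.1 ^ 2)⁻¹ * cofm X.1 i k

/-- The identity matrix. -/
def I0 : Fin 2 → Fin 2 → ℝ := fun i j => pick i (evec j)

lemma cofm_contDiff (i k : Fin 2) : ContDiff ℝ 1 (fun A : Fin 2 → Fin 2 → ℝ => cofm A i k) := by
  unfold cofm; split_ifs <;> fun_prop

lemma Jm_contDiff : ContDiff ℝ 1 Jm := by
  unfold Jm; fun_prop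

lemma Jinv_contDiffAt (X : (Fin 2 → Fin 2 → ℝ) × (Fin 2 → Fin 2 → ℝ) × ℝ) (h : Jm X.1 ≠ 0) :
    ContDiffAt ℝ 1 (fun X : (Fin 2 → Fin 2 → ℝ) × (Fin 2 → Fin 2 → ℝ) × ℝ => (Jm X.1 ^ 2)⁻¹) X := by
  refine ContDiffAt.inv ?_ (pow_ne_zero 2 h)
  exact ((Jm_contDiff.comp contDiff_fst).pow 2).contDiffAt

lemma SV_contDiffAt (i k : Fin 2) (X : (Fin 2 → Fin 2 → ℝ) × (Fin 2 → Fin 2 → ℝ) × ℝ)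
    (h : Jm X.1 ≠ 0) : ContDiffAt ℝ 1 (SV i k) X := by
  refine (Jinv_contDiffAt X h).mul (ContDiff.contDiffAt ?_)
  refine ContDiff.sum fun j _ => ContDiff.mul (ContDiff.sum fun l _ => ?_) (by fun_prop)
  exact ((cofm_contDiff l k).comp contDiff_fst).mul ((cofm_contDiff l j).comp contDiff_fst)

lemma SP_contDiffAt (i k : Fin 2) (X : (Fin 2 → Fin 2 → ℝ) × (Fin 2 → Fin 2 → ℝ) × ℝ)
    (h : Jm X.1 ≠ 0) : ContDiffAt ℝ 1 (SP i k) X := by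
  refine ContDiffAt.mul (ContDiffAt.mul (by fun_prop) (Jinv_contDiffAt X h)) ?_
  exact ((cofm_contDiff i k).comp contDiff_fst).contDiffAt

/-- Total flux. -/
def SS (i k : Fin 2) (X : (Fin 2 → Fin 2 → ℝ) × (Fin 2 → Fin 2 → ℝ) × ℝ) : ℝ :=
  SV i k X - SP i k X

lemma SS_contDiffAt (i k : Fin 2) (X : (Fin 2 → Fin 2 → ℝ) × (Fin 2 → Fin 2 → ℝ) × ℝ)
    (h : Jm X.1 ≠ 0) : ContDiffAt ℝ 1 (SS i k) X :=
  (SV_contDiffAt i k X h).sub (SP_contDiffAt i k X h)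

lemma close_entries {A : Fin 2 → Fin 2 → ℝ} (hA : ∀ i j, |A i j - I0 i j| ≤ 1 / 20) :
    ∃ p q r s : ℝ, A 0 0 = 1 + p ∧ A 0 1 = q ∧ A 1 0 = r ∧ A 1 1 = 1 + s ∧
      |p| ≤ 1 / 20 ∧ |q| ≤ 1 / 20 ∧ |r| ≤ 1 / 20 ∧ |s| ≤ 1 / 20 := by
  have h1 := hA 0 0
  have h2 := hA 0 1
  have h3 := hA 1 0
  have h4 := hA 1 1
  simp [I0, pick, evec] at h1 h2 h3 h4
  refine ⟨A 0 0 - 1, A 0 1, A 1 0, A 1 1 - 1, by ring, rfl, rfl, by ring, ?_, ?_, ?_, ?_⟩ <;>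
    rw [one_div] <;> assumption

lemma Jm_close {A : Fin 2 → Fin 2 → ℝ} (hA : ∀ i j, |A i j - I0 i j| ≤ 1 / 20) :
    9 / 10 ≤ Jm A ∧ Jm A ≤ 111 / 100 := by
  obtain ⟨p, q, r, s, h1, h2, h3, h4, hp, hq, hr, hs⟩ := close_entries hA
  unfold Jm
  rw [h1, h2, h3, h4]
  have hqr : |q * r| ≤ 1 / 20 * (1 / 20) := by
    rw [abs_mul]; exact mul_le_mul hq hr (abs_nonneg _) (by norm_num)
  rw [abs_le] at hp hs hqr
  constructor <;> nlinarith [mul_nonneg (sub_nonneg.2 hp.1) (sub_nonneg.2 hs.1),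
    mul_nonneg (sub_nonneg.2 hp.2) (sub_nonneg.2 hs.2)]

lemma sq_pert (x y p q : ℝ) (hp : |p| ≤ 1 / 20) (hq : |q| ≤ 1 / 20) :
    (p * x + q * y) ^ 2 ≤ 1 / 200 * (x ^ 2 + y ^ 2) := by
  have hp2 : p ^ 2 ≤ 1 / 400 := by
    have := pow_le_pow_left₀ (abs_nonneg p) hp 2
    rw [sq_abs] at this; linarith
  have hq2 : q ^ 2 ≤ 1 / 400 := by
    have := pow_le_pow_left₀ (abs_nonneg q) hq 2
    rw [sq_abs] at this; linarith
  have h : (p * x + q * y) ^ 2 ≤ (p ^ 2 + q ^ 2) * (x ^ 2 + y ^ 2) := by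
    nlinarith [sq_nonneg (p * y - q * x)]
  refine h.trans ?_
  have : 0 ≤ x ^ 2 + y ^ 2 := by positivity
  nlinarith

lemma half_sq (x e : ℝ) : (x + e) ^ 2 ≥ x ^ 2 / 2 - e ^ 2 := by nlinarith [sq_nonneg (x + 2 * e)]

lemma quad_close {A : Fin 2 → Fin 2 → ℝ} (hA : ∀ i j, |A i j - I0 i j| ≤ 1 / 20) (x y : ℝ) :
    1 / 10 * (x ^ 2 + y ^ 2) ≤ (Jm A ^ 2)⁻¹ *
      ((cofm A 0 0 * x + cofm A 0 1 * y) ^ 2 + (cofm A 1 0 * x + cofm A 1 1 * y) ^ 2) := by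
  obtain ⟨hJ1, hJ2⟩ := Jm_close hA
  obtain ⟨p, q, r, s, h1, h2, h3, h4, hp, hq, hr, hs⟩ := close_entries hA
  have hJ : 1 / 4 ≤ (Jm A ^ 2)⁻¹ := by
    rw [one_div]
    refine inv_anti₀ (by positivity) ?_
    nlinarith
  have hlow : 2 / 5 * (x ^ 2 + y ^ 2) ≤
      (cofm A 0 0 * x + cofm A 0 1 * y) ^ 2 + (cofm A 1 0 * x + cofm A 1 1 * y) ^ 2 := by
    simp [cofm, h1, h2, h3, h4]
    have e1 := sq_pert x y s (-r) hs (by rwa [abs_neg])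
    have e2 := sq_pert x y (-q) p (by rwa [abs_neg]) hp
    have f1 := half_sq x (s * x + -r * y)
    have f2 := half_sq y (-q * x + p * y)
    have g1 : (1 + s) * x + -(r * y) = x + (s * x + -r * y) := by ring
    have g2 : -(q * x) + (1 + p) * y = y + (-q * x + p * y) := by ring
    rw [g1, g2]
    nlinarith [sq_nonneg x, sq_nonneg y]
  have h0 : 0 ≤ x ^ 2 + y ^ 2 := by positivity
  calc 1 / 10 * (x ^ 2 + y ^ 2) = 1 / 4 * (2 / 5 * (x ^ 2 + y ^ 2)) := by ring
    _ ≤ _ := mul_le_mul hJ hlow (by positivity) (by positivity)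

lemma coercive {A : Fin 2 → Fin 2 → ℝ} (hA : ∀ i j, |A i j - I0 i j| ≤ 1 / 20)
    (B B' : Fin 2 → Fin 2 → ℝ) (r : ℝ) :
    1 / 10 * ∑ i, ∑ k, (B i k - B' i k) ^ 2 ≤
      ∑ i, ∑ k, (B i k - B' i k) * (SS i k (A, B, r) - SS i k (A, B', r)) := by
  have h0 := quad_close hA (B 0 0 - B' 0 0) (B 0 1 - B' 0 1)
  have h1 := quad_close hA (B 1 0 - B' 1 0) (B 1 1 - B' 1 1)
  simp only [SS, SV, SP, Fin.sum_univ_two]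
  refine le_trans ?_ ((add_le_add h0 h1).trans_eq ?_)
  · apply le_of_eq; ring
  · ring

/-- Compact parameter set. -/
def KK (R : ℝ) : Set ((Fin 2 → Fin 2 → ℝ) × (Fin 2 → Fin 2 → ℝ) × ℝ) :=
  Metric.closedBall I0 (1 / 20) ×ˢ Metric.closedBall 0 R ×ˢ Metric.closedBall 0 R

lemma mem_close {A : Fin 2 → Fin 2 → ℝ} :
    A ∈ Metric.closedBall I0 (1 / 20) ↔ ∀ i j, |A i j - I0 i j| ≤ 1 / 20 := by
  rw [mem_closedBall_iff_norm, pi_norm_le_iff_of_nonneg (by norm_num)]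
  refine forall_congr' fun i => ?_
  rw [pi_norm_le_iff_of_nonneg (by norm_num)]
  rfl

lemma SS_lip (R : ℝ) (i k : Fin 2) : ∃ L : NNReal, LipschitzOnWith L (SS i k) (KK R) := by
  have hK : IsCompact (KK R) :=
    (isCompact_closedBall _ _).prod ((isCompact_closedBall _ _).prod (isCompact_closedBall _ _))
  refine LocallyLipschitzOn.exists_lipschitzOnWith_of_compact hK ?_
  intro X hX
  have hJ := (Jm_close (mem_close.1 hX.1)).1
  obtain ⟨K, t, ht, hL⟩ :=
    (SS_contDiffAt i k X (by linarith)).exists_lipschitzOnWith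
  exact ⟨K, t, mem_nhdsWithin_of_mem_nhds ht, hL⟩

lemma pointwise_ineq (R : ℝ) : ∃ C : ℝ, 0 ≤ C ∧ ∀ A A' B B' : Fin 2 → Fin 2 → ℝ, ∀ r : ℝ,
    (A, B, r) ∈ KK R → (A', B', r) ∈ KK R →
    2 * ∑ i, ∑ k, (A i k - A' i k) * (B i k - B' i k)
      - 2 * ∑ i, ∑ k, (B i k - B' i k) * (SS i k (A, B, r) - SS i k (A', B', r))
      ≤ C * ∑ i, ∑ k, (A i k - A' i k) ^ 2 := by
  choose L hL using fun i k => SS_lip R i k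
  obtain ⟨M, hM⟩ : ∃ M : ℝ, ∀ i k, (L i k : ℝ) ≤ M := by
    refine ⟨∑ i, ∑ k, (L i k : ℝ), fun i k => ?_⟩
    refine le_trans ?_ (Finset.single_le_sum (f := fun i => ∑ k, (L i k : ℝ))
      (fun _ _ => by positivity) (Finset.mem_univ i))
    exact Finset.single_le_sum (f := fun k => (L i k : ℝ)) (fun _ _ => by positivity)
      (Finset.mem_univ k)
  refine ⟨20 * (M + 1) ^ 2, by positivity, ?_⟩
  intro A A' B B' r hX hX'
  have hcl := mem_close.1 hX.1
  have hco := coercive hcl B B' r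
  set n := ‖A - A'‖ with hn
  have hn0 : 0 ≤ n := norm_nonneg _
  have hent : ∀ i k, |A i k - A' i k| ≤ n := fun i k =>
    (norm_le_pi_norm ((A - A') i) k).trans (norm_le_pi_norm (A - A') i)
  have hn2 : n ^ 2 ≤ ∑ i, ∑ k, (A i k - A' i k) ^ 2 := by
    have hle : n ≤ √(∑ i, ∑ k, (A i k - A' i k) ^ 2) := by
      rw [hn, pi_norm_le_iff_of_nonneg (Real.sqrt_nonneg _)]
      intro i
      rw [pi_norm_le_iff_of_nonneg (Real.sqrt_nonneg _)]
      intro k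
      refine Real.le_sqrt_of_sq_le ?_
      rw [Real.norm_eq_abs, sq_abs]
      refine le_trans ?_ (Finset.single_le_sum (f := fun i => ∑ k, (A i k - A' i k) ^ 2)
        (fun _ _ => by positivity) (Finset.mem_univ i))
      exact Finset.single_le_sum (f := fun k => (A i k - A' i k) ^ 2) (fun _ _ => by positivity)
        (Finset.mem_univ k)
    calc n ^ 2 ≤ (√(∑ i, ∑ k, (A i k - A' i k) ^ 2)) ^ 2 := by gcongr
      _ = _ := Real.sq_sqrt (by positivity)
  have hmid : ((A, B', r) : (Fin 2 → Fin 2 → ℝ) × (Fin 2 → Fin 2 → ℝ) × ℝ) ∈ KK R :=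
    ⟨hX.1, hX'.2⟩
  have hlip : ∀ i k, |SS i k (A, B', r) - SS i k (A', B', r)| ≤ M * n := by
    intro i k
    have := (hL i k).dist_le_mul _ hmid _ hX'
    rw [Real.dist_eq] at this
    refine this.trans ?_
    have hd : dist ((A, B', r) : (Fin 2 → Fin 2 → ℝ) × (Fin 2 → Fin 2 → ℝ) × ℝ) (A', B', r) = n := by
      rw [Prod.dist_eq]
      simp [hn, dist_eq_norm]
    rw [hd]
    exact mul_le_mul_of_nonneg_right (hM i k) hn0
  have hM0 : 0 ≤ M := (L 0 0).2.trans (hM 0 0)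
  have hterm : ∀ i k, 2 * ((A i k - A' i k) * (B i k - B' i k))
      - 2 * ((B i k - B' i k) * (SS i k (A, B', r) - SS i k (A', B', r)))
      - 1 / 5 * (B i k - B' i k) ^ 2 ≤ 5 * (M + 1) ^ 2 * n ^ 2 := by
    intro i k
    generalize hw : B i k - B' i k = w
    have hz : |(A i k - A' i k) - (SS i k (A, B', r) - SS i k (A', B', r))| ≤ (M + 1) * n := by
      refine (abs_sub _ _).trans ?_
      have := hent i k
      have := hlip i k
      linarith
    generalize hzz : (A i k - A' i k) - (SS i k (A, B', r) - SS i k (A', B', r)) = z at hz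
    have hz2 : z ^ 2 ≤ ((M + 1) * n) ^ 2 := by
      rw [← sq_abs z]; gcongr
    have : 2 * ((A i k - A' i k) * w)
      - 2 * (w * (SS i k (A, B', r) - SS i k (A', B', r))) = 2 * w * z := by
      rw [← hzz]; ring
    rw [this]
    nlinarith [sq_nonneg (w - 5 * z)]
  have t00 := hterm 0 0
  have t01 := hterm 0 1
  have t10 := hterm 1 0
  have t11 := hterm 1 1
  have hfin : 20 * (M + 1) ^ 2 * n ^ 2 ≤ 20 * (M + 1) ^ 2 * ∑ i, ∑ k, (A i k - A' i k) ^ 2 :=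
    mul_le_mul_of_nonneg_left hn2 (by positivity)
  refine le_trans ?_ hfin
  simp only [Fin.sum_univ_two] at hco ⊢
  linarith

/-- The state `(Dη, Dv, ρ₀)`. -/
def XX (ρ₀ : ℝ × ℝ → ℝ) (v : ℝ → ℝ × ℝ → ℝ × ℝ) (t : ℝ) (x : ℝ × ℝ) :
    (Fin 2 → Fin 2 → ℝ) × (Fin 2 → Fin 2 → ℝ) × ℝ :=
  (fun i j => AA v i j t x, fun i j => BB v i j t x, ρ₀ x)

lemma BB_slice_contDiff {v : ℝ → ℝ × ℝ → ℝ × ℝ} (hv : SmoothT v) (i j : Fin 2) (t : ℝ) :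
    ContDiff ℝ 1 (BB v i j t) :=
  (BB_contDiff hv i j).comp (contDiff_prodMk_right t)

lemma XX_diff {ρ₀ : ℝ × ℝ → ℝ} (hρ : SmoothFn ρ₀) {v : ℝ → ℝ × ℝ → ℝ × ℝ} (hv : SmoothT v)
    (t : ℝ) : Differentiable ℝ (XX ρ₀ v t) := by
  unfold XX
  refine Differentiable.prodMk ?_ (Differentiable.prodMk ?_ ?_)
  · exact differentiable_pi.2 fun i => differentiable_pi.2 fun j => AA_diff hv i j t
  · exact differentiable_pi.2 fun i => differentiable_pi.2 fun j =>
      (BB_slice_contDiff hv i j t).differentiable (by norm_num)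
  · exact (hρ 1).differentiable (by norm_num)

lemma jac_eq {v : ℝ → ℝ × ℝ → ℝ × ℝ} (hv : SmoothT v) (t : ℝ) (y : ℝ × ℝ) :
    jac (flowMap v t) y = Jm (fun i j => AA v i j t y) := by
  simp only [Jm, ← flow_pd hv]
  simp [jac, pd1, pd2, pdk, pick, evec]

lemma cof_eq {v : ℝ → ℝ × ℝ → ℝ × ℝ} (hv : SmoothT v) (t : ℝ) (y : ℝ × ℝ) (i k : Fin 2) :
    cof (flowMap v t) y i k = cofm (fun i j => AA v i j t y) i k := by
  simp only [cofm, ← flow_pd hv]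
  simp [cof, pd1, pd2, pdk, pick, evec]

lemma zpow_neg_two (a : ℝ) : a ^ (-2 : ℤ) = (a ^ 2)⁻¹ := by
  rw [zpow_neg]; norm_cast

lemma pdk_sub (k : Fin 2) {f g : ℝ × ℝ → ℝ} {x : ℝ × ℝ} (hf : DifferentiableAt ℝ f x)
    (hg : DifferentiableAt ℝ g x) :
    pdk k (fun y => f y - g y) x = pdk k f x - pdk k g x := by
  unfold pdk; rw [fderiv_fun_sub hf hg]; rfl

lemma pdk_add (k : Fin 2) {f g : ℝ × ℝ → ℝ} {x : ℝ × ℝ} (hf : DifferentiableAt ℝ f x)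
    (hg : DifferentiableAt ℝ g x) :
    pdk k (fun y => f y + g y) x = pdk k f x + pdk k g x := by
  unfold pdk; rw [fderiv_fun_add hf hg]; rfl

lemma pdk_mul (k : Fin 2) {f g : ℝ × ℝ → ℝ} {x : ℝ × ℝ} (hf : DifferentiableAt ℝ f x)
    (hg : DifferentiableAt ℝ g x) :
    pdk k (fun y => f y * g y) x = f x * pdk k g x + pdk k f x * g x := by
  unfold pdk; rw [fderiv_fun_mul hf hg]; simp [mul_comm]

/-- The flux along a solution. -/
def HH (ρ₀ : ℝ × ℝ → ℝ) (v : ℝ → ℝ × ℝ → ℝ × ℝ) (t : ℝ) (i k : Fin 2) (y : ℝ × ℝ) : ℝ :=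
  ρ₀ y * SS i k (XX ρ₀ v t y)

lemma HH_diff {ρ₀ : ℝ × ℝ → ℝ} (hρ : SmoothFn ρ₀) {v : ℝ → ℝ × ℝ → ℝ × ℝ} (hv : SmoothT v)
    (t : ℝ) (i k : Fin 2) (x : ℝ × ℝ) (hJ : Jm (fun i j => AA v i j t x) ≠ 0) :
    DifferentiableAt ℝ (HH ρ₀ v t i k) x := by
  refine DifferentiableAt.mul ((hρ 1).differentiable (by norm_num) x) ?_
  exact DifferentiableAt.comp x
    ((SS_contDiffAt i k (XX ρ₀ v t x) hJ).differentiableAt (by norm_num)) (XX_diff hρ hv t x)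

lemma sol_eq {ρ₀ : ℝ × ℝ → ℝ} (hρ : SmoothFn ρ₀) {v : ℝ → ℝ × ℝ → ℝ × ℝ} (hv : SmoothT v)
    {T : ℝ} (hsol : IsLagSol ρ₀ v T) (t : ℝ) (h0 : 0 < t) (hT : t ≤ T) (x : ℝ × ℝ)
    (hx : x ∈ Oset) (i : Fin 2) (hJ : Jm (fun i j => AA v i j t x) ≠ 0) :
    ρ₀ x * pick i (pdt v t x) = ∑ k : Fin 2, pdk k (HH ρ₀ v t i k) x := by
  have h := hsol t h0 hT x hx i
  have hρd : DifferentiableAt ℝ ρ₀ x := (hρ 1).differentiable (by norm_num) x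
  have hV : ∀ k, DifferentiableAt ℝ (fun y => ρ₀ y * SV i k (XX ρ₀ v t y)) x := fun k =>
    hρd.mul (DifferentiableAt.comp x
      ((SV_contDiffAt i k (XX ρ₀ v t x) hJ).differentiableAt (by norm_num)) (XX_diff hρ hv t x))
  have hP : ∀ k, DifferentiableAt ℝ (fun y => ρ₀ y * SP i k (XX ρ₀ v t y)) x := fun k =>
    hρd.mul (DifferentiableAt.comp x
      ((SP_contDiffAt i k (XX ρ₀ v t x) hJ).differentiableAt (by norm_num)) (XX_diff hρ hv t x))
  have e : ∀ k, pdk k (HH ρ₀ v t i k) x = pdk k (fun y => ρ₀ y * SV i k (XX ρ₀ v t y)) x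
      - pdk k (fun y => ρ₀ y * SP i k (XX ρ₀ v t y)) x := by
    intro k
    rw [← pdk_sub k (hV k) (hP k)]
    congr 1
    funext y
    simp only [HH, SS]; ring
  have eP : ∀ k, (fun y => ρ₀ y ^ 2 * jac (flowMap v t) y ^ (-2 : ℤ) * cof (flowMap v t) y i k)
      = fun y => ρ₀ y * SP i k (XX ρ₀ v t y) := by
    intro k; funext y
    rw [zpow_neg_two, jac_eq hv, cof_eq hv]
    simp only [SP, XX]; ring
  have eV : ∀ k, (fun y => ρ₀ y * jac (flowMap v t) y ^ (-2 : ℤ) *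
            ∑ j : Fin 2, bmat (flowMap v t) y k j * pdk j (fun z => pick i (v t z)) y)
      = fun y => ρ₀ y * SV i k (XX ρ₀ v t y) := by
    intro k; funext y
    rw [zpow_neg_two, jac_eq hv]
    simp only [SV, XX, bmat, cof_eq hv, BB]; ring
  simp only [eP, eV] at h
  simp only [e, Finset.sum_sub_distrib]
  linarith

/-- The time derivative of the components. -/
def TT (v : ℝ → ℝ × ℝ → ℝ × ℝ) (i : Fin 2) (t : ℝ) (x : ℝ × ℝ) : ℝ :=
  fderiv ℝ (UU v i) (t, x) (1, 0)

lemma TT_cont {v : ℝ → ℝ × ℝ → ℝ × ℝ} (hv : SmoothT v) (i : Fin 2) :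
    Continuous (fun p : ℝ × (ℝ × ℝ) => TT v i p.1 p.2) :=
  ((UU_contDiff hv i 1).continuous_fderiv (by norm_num)).clm_apply continuous_const

lemma TT_deriv {v : ℝ → ℝ × ℝ → ℝ × ℝ} (hv : SmoothT v) (i : Fin 2) (t : ℝ) (x : ℝ × ℝ) :
    HasDerivAt (fun s => UU v i (s, x)) (TT v i t x) t := by
  have h1 : HasFDerivAt (UU v i) (fderiv ℝ (UU v i) (t, x)) (t, x) :=
    ((UU_contDiff hv i 1).differentiable (by norm_num) (t, x)).hasFDerivAt
  have h3 : HasFDerivAt (fun s : ℝ => (s, x)) (ContinuousLinearMap.inl ℝ ℝ (ℝ × ℝ)) t :=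
    hasFDerivAt_prodMk_left t x
  have h2 := HasFDerivAt.comp t h1 h3
  exact h2.hasDerivAt

lemma TT_eq {v : ℝ → ℝ × ℝ → ℝ × ℝ} (hv : SmoothT v) (i : Fin 2) (t : ℝ) (x : ℝ × ℝ) :
    pick i (pdt v t x) = TT v i t x := by
  have hd : DifferentiableAt ℝ (fun s => v s x) t := by
    have : ContDiff ℝ 1 (fun s => v s x) := (hv 1).comp (contDiff_prodMk_left x)
    exact this.differentiable (by norm_num) t
  have h1 : HasDerivAt (fun s => UU v i (s, x)) (pickL i (pdt v t x)) t := by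
    have := (pickL i).hasFDerivAt.comp_hasDerivAt t hd.hasDerivAt
    refine this.congr_of_eventuallyEq (Eventually.of_forall fun z => ?_)
    simp [pickL_apply, UU]
  rw [← pickL_apply]
  exact h1.unique (TT_deriv hv i t x)

/-- The energy identity for the difference of two solutions. -/
lemma energy_identity {ρ₀ : ℝ × ℝ → ℝ} (hρ : SmoothFn ρ₀) (hρp : Per ρ₀)
    (hρ0 : ∀ x ∈ Gset, ρ₀ x = 0) {v vt : ℝ → ℝ × ℝ → ℝ × ℝ}
    (hv : SmoothT v) (hvper : PerT v) (hvt : SmoothT vt) (hvtper : PerT vt) {T : ℝ}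
    (hsol : IsLagSol ρ₀ v T) (hsol' : IsLagSol ρ₀ vt T) (t : ℝ) (h0 : 0 < t) (hT : t ≤ T)
    (hJ : ∀ x ∈ Sq, Jm (fun i j => AA v i j t x) ≠ 0)
    (hJ' : ∀ x ∈ Sq, Jm (fun i j => AA vt i j t x) ≠ 0) :
    IntegrableOn (fun x => (∑ i, ∑ k, (BB v i k t x - BB vt i k t x) *
        (HH ρ₀ v t i k x - HH ρ₀ vt t i k x)) +
      ∑ i, (UU v i (t, x) - UU vt i (t, x)) * (ρ₀ x * (TT v i t x - TT vt i t x))) Sq ∧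
    ∫ x in Sq, ((∑ i, ∑ k, (BB v i k t x - BB vt i k t x) *
        (HH ρ₀ v t i k x - HH ρ₀ vt t i k x)) +
      ∑ i, (UU v i (t, x) - UU vt i (t, x)) * (ρ₀ x * (TT v i t x - TT vt i t x))) = 0 := by
  set RHS : ℝ × ℝ → ℝ := fun x => (∑ i, ∑ k, (BB v i k t x - BB vt i k t x) *
        (HH ρ₀ v t i k x - HH ρ₀ vt t i k x)) +
      ∑ i, (UU v i (t, x) - UU vt i (t, x)) * (ρ₀ x * (TT v i t x - TT vt i t x)) with hRHS
  have hUd : ∀ i x, DifferentiableAt ℝ (fun y => UU v i (t, y) - UU vt i (t, y)) x := fun i x =>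
    (UU_slice hv i t x).differentiableAt.sub (UU_slice hvt i t x).differentiableAt
  have hHd : ∀ i k, ∀ x ∈ Sq,
      DifferentiableAt ℝ (fun y => HH ρ₀ v t i k y - HH ρ₀ vt t i k y) x := fun i k x hx =>
    (HH_diff hρ hv t i k x (hJ x hx)).sub (HH_diff hρ hvt t i k x (hJ' x hx))
  have hBc : ∀ i k, Continuous (fun y => BB v i k t y - BB vt i k t y) := fun i k =>
    (BB_slice_contDiff hv i k t).continuous.sub (BB_slice_contDiff hvt i k t).continuous
  have hTc : ∀ i, Continuous (fun y => TT v i t y - TT vt i t y) := fun i =>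
    ((TT_cont hv i).comp (by fun_prop : Continuous fun y : ℝ × ℝ => (t, y))).sub
      ((TT_cont hvt i).comp (by fun_prop : Continuous fun y : ℝ × ℝ => (t, y)))
  have hUc : ∀ i, Continuous (fun y => UU v i (t, y) - UU vt i (t, y)) := fun i =>
    (fun x => (hUd i x).continuousAt : ∀ x, _) |> continuous_iff_continuousAt.2
  have hHc : ∀ i k, ContinuousOn (fun y => HH ρ₀ v t i k y - HH ρ₀ vt t i k y) Sq :=
    fun i k x hx => (hHd i k x hx).continuousAt.continuousWithinAt
  have hRc : ContinuousOn RHS Sq := by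
    refine ContinuousOn.add ?_ ?_
    · refine continuousOn_finsetSum _ fun i _ => continuousOn_finsetSum _ fun k _ => ?_
      exact (hBc i k).continuousOn.mul (hHc i k)
    · refine continuousOn_finsetSum _ fun i _ => ?_
      exact (hUc i).continuousOn.mul ((hρ 1).continuous.continuousOn.mul (hTc i).continuousOn)
  have hRi : IntegrableOn RHS Sq := hRc.integrableOn_compact Sq_compact
  refine ⟨hRi, ?_⟩
  let G : Fin 2 → ℝ × ℝ → ℝ := fun k y =>
    ∑ i, (UU v i (t, y) - UU vt i (t, y)) * (HH ρ₀ v t i k y - HH ρ₀ vt t i k y)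
  have hGd : ∀ k, ∀ x ∈ Sq, DifferentiableAt ℝ (G k) x := fun k x hx =>
    DifferentiableAt.fun_sum fun i _ => (hUd i x).mul (hHd i k x hx)
  have hGp : ∀ k, ∀ x ∈ Sq, pdk k (G k) x = ∑ i,
      ((UU v i (t, x) - UU vt i (t, x)) * (pdk k (HH ρ₀ v t i k) x - pdk k (HH ρ₀ vt t i k) x)
      + (BB v i k t x - BB vt i k t x) * (HH ρ₀ v t i k x - HH ρ₀ vt t i k x)) := by
    intro k x hx
    simp only [G, Fin.sum_univ_two]
    rw [pdk_add k ((hUd 0 x).fun_mul (hHd 0 k x hx)) ((hUd 1 x).fun_mul (hHd 1 k x hx)),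
      pdk_mul k (hUd 0 x) (hHd 0 k x hx), pdk_mul k (hUd 1 x) (hHd 1 k x hx)]
    simp only [fun i => pdk_sub k (HH_diff hρ hv t i k x (hJ x hx))
      (HH_diff hρ hvt t i k x (hJ' x hx))]
    have : ∀ i, pdk k (fun y => UU v i (t, y) - UU vt i (t, y)) x
        = BB v i k t x - BB vt i k t x := fun i =>
      pdk_sub k (UU_slice hv i t x).differentiableAt (UU_slice hvt i t x).differentiableAt
    rw [this, this]
  have hdiv : ∀ x ∈ Oset, fderiv ℝ (G 0) x (1, 0) + fderiv ℝ (G 1) x (0, 1) = RHS x := by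
    intro x hx
    have hxS := Oset_sub_Sq hx
    have e0 : fderiv ℝ (G 0) x (1, 0) = pdk 0 (G 0) x := by simp [pdk, evec]
    have e1 : fderiv ℝ (G 1) x (0, 1) = pdk 1 (G 1) x := by simp [pdk, evec]
    have s := fun i => sol_eq hρ hv hsol t h0 hT x hx i (hJ x hxS)
    have s' := fun i => sol_eq hρ hvt hsol' t h0 hT x hx i (hJ' x hxS)
    have f : ∀ i, ρ₀ x * (TT v i t x - TT vt i t x) =
        ∑ k, pdk k (HH ρ₀ v t i k) x - ∑ k, pdk k (HH ρ₀ vt t i k) x := by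
      intro i
      rw [← s, ← s', TT_eq hv, TT_eq hvt]; ring
    rw [e0, e1, hGp 0 x hxS, hGp 1 x hxS, hRHS]
    simp only [f, Fin.sum_univ_two]
    ring
  have hae : ∀ᵐ x ∂(volume.restrict Sq),
      fderiv ℝ (G 0) x (1, 0) + fderiv ℝ (G 1) x (0, 1) = RHS x := by
    rw [← Measure.restrict_congr_set Sq_ae]
    exact (ae_restrict_iff' Oset_open.measurableSet).2 (Eventually.of_forall hdiv)
  have hthm := integral_divergence_prod_Icc_of_hasFDerivAt_of_le (G 0) (G 1)
    (fderiv ℝ (G 0)) (fderiv ℝ (G 1)) (0, 0) (1, 1) (by constructor <;> norm_num)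
    (fun x hx => (hGd 0 x hx).continuousAt.continuousWithinAt)
    (fun x hx => (hGd 1 x hx).continuousAt.continuousWithinAt)
    (fun x hx => (hGd 0 x (Oset_sub_Sq hx)).hasFDerivAt)
    (fun x hx => (hGd 1 x (Oset_sub_Sq hx)).hasFDerivAt)
    (hRi.congr_fun_ae (hae.mono fun x hx => hx.symm))
  have hL : ∫ x in Sq, RHS x = ∫ x in Set.Icc ((0:ℝ), (0:ℝ)) (1, 1),
      fderiv ℝ (G 0) x (1, 0) + fderiv ℝ (G 1) x (0, 1) :=
    integral_congr_ae (hae.mono fun x hx => hx.symm)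
  rw [hL, hthm]
  have b1 : ∀ x : ℝ, G 1 (x, 1) = 0 := fun x => by
    have : ρ₀ (x, 1) = 0 := hρ0 _ (Or.inr rfl)
    simp [G, HH, this]
  have b0 : ∀ x : ℝ, G 1 (x, 0) = 0 := fun x => by
    have : ρ₀ (x, 0) = 0 := hρ0 _ (Or.inl rfl)
    simp [G, HH, this]
  have hper : ∀ y : ℝ, G 0 (1, y) = G 0 (0, y) := fun y => by
    have hA := fun i j => AA_per hvper i j t (0, y)
    have hB := fun i j => BB_per hvper i j t (0, y)
    have hA' := fun i j => AA_per hvtper i j t (0, y)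
    have hB' := fun i j => BB_per hvtper i j t (0, y)
    have hr := hρp (0, y)
    have hV := hvper t (0, y)
    have hV' := hvtper t (0, y)
    simp only [zero_add] at hA hB hA' hB' hr hV hV'
    simp only [G, HH, XX, UU, hA, hB, hA', hB', hr, hV, hV']
  simp only [b1, b0, hper]
  simp

/-- (Section 11: uniqueness of classical solutions.)
Two smooth solutions of the Lagrangian system with the same initial data, each
satisfying the a priori assumption, coincide on `Ω × (0,T]`. -/
theorem stmt18 (C₁ C₂ : ℝ) (hC₁ : 0 < C₁) (hC₁₂ : C₁ ≤ C₂)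
    (ρ₀ : ℝ × ℝ → ℝ) (hρ : IsDensity C₁ C₂ ρ₀)
    (T : ℝ) (v vt : ℝ → ℝ × ℝ → ℝ × ℝ)
    (hv : SmoothT v) (hvper : PerT v) (hvt : SmoothT vt) (hvtper : PerT vt)
    (hsol : IsLagSol ρ₀ v T) (hsol' : IsLagSol ρ₀ vt T)
    (M₁ c₁ c₂ M₁' c₁' c₂' : ℝ)
    (hap : Apriori ρ₀ v T M₁ c₁ c₂) (hap' : Apriori ρ₀ vt T M₁' c₁' c₂')
    (h0 : ∀ x ∈ Oset, v 0 x = vt 0 x) :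
    ∀ t : ℝ, 0 < t → t ≤ T → ∀ x ∈ Oset, v t x = vt t x := by
  obtain ⟨hρs, hρp, hρ0, hρb⟩ := hρ
  have hTpos : 0 < T := hap.2.2.2.1
  have hρnn : ∀ x ∈ Oset, 0 < ρ₀ x := by
    intro x hx
    refine lt_of_lt_of_le (mul_pos hC₁ ?_) (hρb x hx).1
    exact lt_min hx.2.1 (by linarith [hx.2.2])
  have hρnn' : ∀ x ∈ Sq, 0 ≤ ρ₀ x := by
    intro x hx
    rw [Sq_eq_closure] at hx
    exact closure_minimal (fun y hy => (hρnn y hy).le)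
      (isClosed_le continuous_const (hρs 0).continuous) hx
  have hρc : Continuous ρ₀ := (hρs 0).continuous
  have hA := fun i j => AA_close hv hap i j
  have hA' := fun i j => AA_close hvt hap' i j
  obtain ⟨R, hR⟩ : ∃ R : ℝ, ∀ t ∈ Set.Icc 0 T, ∀ x ∈ Sq,
      XX ρ₀ v t x ∈ KK R ∧ XX ρ₀ vt t x ∈ KK R := by
    have hK : IsCompact (Set.Icc 0 T ×ˢ Sq : Set (ℝ × (ℝ × ℝ))) := isCompact_Icc.prod Sq_compact
    have hcont : Continuous (fun p : ℝ × (ℝ × ℝ) =>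
        (((fun i j => BB v i j p.1 p.2 : Fin 2 → Fin 2 → ℝ),
          (fun i j => BB vt i j p.1 p.2 : Fin 2 → Fin 2 → ℝ)), ρ₀ p.2)) := by
      refine Continuous.prodMk (Continuous.prodMk ?_ ?_) (hρc.comp continuous_snd)
      · exact continuous_pi fun i => continuous_pi fun j => (BB_contDiff hv i j).continuous
      · exact continuous_pi fun i => continuous_pi fun j => (BB_contDiff hvt i j).continuous
    obtain ⟨R, hR⟩ := hK.exists_bound_of_continuousOn hcont.continuousOn
    refine ⟨R, fun t ht x hx => ?_⟩
    have h := hR (t, x) ⟨ht, hx⟩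
    have h1 := (norm_fst_le _).trans h
    have h2 := (norm_snd_le _).trans h
    have h3 := (norm_fst_le _).trans h1
    have h4 := (norm_snd_le _).trans h1
    exact ⟨⟨mem_close.2 fun i j => hA i j t ht x hx, mem_closedBall_zero_iff.2 h3,
        mem_closedBall_zero_iff.2 h2⟩,
      ⟨mem_close.2 fun i j => hA' i j t ht x hx, mem_closedBall_zero_iff.2 h4,
        mem_closedBall_zero_iff.2 h2⟩⟩
  obtain ⟨C, hC0, hC⟩ := pointwise_ineq R
  let g : ℝ → ℝ × ℝ → ℝ := fun t x => ρ₀ x * (∑ i, (UU v i (t, x) - UU vt i (t, x)) ^ 2 +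
    ∑ i, ∑ k, (AA v i k t x - AA vt i k t x) ^ 2)
  let g' : ℝ → ℝ × ℝ → ℝ := fun t x => ρ₀ x *
    (∑ i, 2 * (UU v i (t, x) - UU vt i (t, x)) * (TT v i t x - TT vt i t x) +
    ∑ i, ∑ k, 2 * (AA v i k t x - AA vt i k t x) * (BB v i k t x - BB vt i k t x))
  have cU : ∀ i, Continuous fun p : ℝ × (ℝ × ℝ) => UU v i (p.1, p.2) - UU vt i (p.1, p.2) :=
    fun i => (UU_contDiff hv i 0).continuous.sub (UU_contDiff hvt i 0).continuous
  have cA : ∀ i k, Continuous fun p : ℝ × (ℝ × ℝ) => AA v i k p.1 p.2 - AA vt i k p.1 p.2 :=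
    fun i k => (AA_cont hv i k).sub (AA_cont hvt i k)
  have cB : ∀ i k, Continuous fun p : ℝ × (ℝ × ℝ) => BB v i k p.1 p.2 - BB vt i k p.1 p.2 :=
    fun i k => (BB_contDiff hv i k).continuous.sub (BB_contDiff hvt i k).continuous
  have cT : ∀ i, Continuous fun p : ℝ × (ℝ × ℝ) => TT v i p.1 p.2 - TT vt i p.1 p.2 :=
    fun i => (TT_cont hv i).sub (TT_cont hvt i)
  have hgc : Continuous fun p : ℝ × (ℝ × ℝ) => g p.1 p.2 := by
    refine (hρc.comp continuous_snd).mul (Continuous.add ?_ ?_)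
    · exact continuous_finsetSum _ fun i _ => (cU i).pow 2
    · exact continuous_finsetSum _ fun i _ => continuous_finsetSum _ fun k _ => (cA i k).pow 2
  have hgc' : Continuous fun p : ℝ × (ℝ × ℝ) => g' p.1 p.2 := by
    refine (hρc.comp continuous_snd).mul (Continuous.add ?_ ?_)
    · exact continuous_finsetSum _ fun i _ => (continuous_const.mul (cU i)).mul (cT i)
    · exact continuous_finsetSum _ fun i _ => continuous_finsetSum _ fun k _ =>
        (continuous_const.mul (cA i k)).mul (cB i k)
  have hgd : ∀ t x, HasDerivAt (fun s => g s x) (g' t x) t := by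
    intro t x
    refine HasDerivAt.const_mul _ (HasDerivAt.add ?_ ?_)
    · refine HasDerivAt.fun_sum fun i _ => ?_
      have := ((TT_deriv hv i t x).fun_sub (TT_deriv hvt i t x)).fun_pow 2
      simpa using this
    · refine HasDerivAt.fun_sum fun i _ => HasDerivAt.fun_sum fun k _ => ?_
      have := ((AA_deriv hv i k t x).fun_sub (AA_deriv hvt i k t x)).fun_pow 2
      simpa using this
  have hΦd := hasDerivAt_space_integral g g' hgc hgc' hgd
  have hgs : ∀ s, Continuous (g s) := fun s =>
    hgc.comp (by fun_prop : Continuous fun x : ℝ × ℝ => (s, x))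
  have hgs' : ∀ s, Continuous (g' s) := fun s =>
    hgc'.comp (by fun_prop : Continuous fun x : ℝ × ℝ => (s, x))
  have hgi : ∀ s, IntegrableOn (g s) Sq := fun s =>
    (hgs s).continuousOn.integrableOn_compact Sq_compact
  have hgi' : ∀ s, IntegrableOn (g' s) Sq := fun s =>
    (hgs' s).continuousOn.integrableOn_compact Sq_compact
  have hgnn : ∀ s, ∀ x ∈ Sq, 0 ≤ g s x := fun s x hx => mul_nonneg (hρnn' x hx) (by positivity)
  have hineq : ∀ t, 0 < t → t ≤ T → ∫ x in Sq, g' t x ≤ C * ∫ x in Sq, g t x := by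
    intro t h0t htT
    have ht : t ∈ Set.Icc 0 T := ⟨h0t.le, htT⟩
    obtain ⟨hI, hE⟩ := energy_identity hρs hρp hρ0 hv hvper hvt hvtper hsol hsol' t h0t htT
      (fun x hx => by
        have := (Jm_close (A := fun i j => AA v i j t x) fun i j => hA i j t ht x hx).1
        linarith)
      (fun x hx => by
        have := (Jm_close (A := fun i j => AA vt i j t x) fun i j => hA' i j t ht x hx).1
        linarith)
    rw [← integral_const_mul]
    have e : ∫ x in Sq, g' t x = ∫ x in Sq, (g' t x - 2 * ((∑ i, ∑ k,
        (BB v i k t x - BB vt i k t x) * (HH ρ₀ v t i k x - HH ρ₀ vt t i k x)) +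
      ∑ i, (UU v i (t, x) - UU vt i (t, x)) * (ρ₀ x * (TT v i t x - TT vt i t x)))) := by
      rw [integral_sub (hgi' t) (hI.const_mul 2), integral_const_mul, hE]; ring
    rw [e]
    refine setIntegral_mono_on ((hgi' t).sub (hI.const_mul 2)) ((hgi t).const_mul C)
      Sq_compact.measurableSet ?_
    intro x hx
    have hp := hC _ _ _ _ _ (hR t ht x hx).1 (hR t ht x hx).2
    have hp2 := mul_le_mul_of_nonneg_left hp (hρnn' x hx)
    have hq : 0 ≤ C * (ρ₀ x * ∑ i, (UU v i (t, x) - UU vt i (t, x)) ^ 2) :=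
      mul_nonneg hC0 (mul_nonneg (hρnn' x hx) (by positivity))
    have eL : g' t x - 2 * ((∑ i, ∑ k,
        (BB v i k t x - BB vt i k t x) * (HH ρ₀ v t i k x - HH ρ₀ vt t i k x)) +
      ∑ i, (UU v i (t, x) - UU vt i (t, x)) * (ρ₀ x * (TT v i t x - TT vt i t x))) =
      ρ₀ x * (2 * ∑ i, ∑ k, (AA v i k t x - AA vt i k t x) * (BB v i k t x - BB vt i k t x)
      - 2 * ∑ i, ∑ k, (BB v i k t x - BB vt i k t x) *
        (SS i k (XX ρ₀ v t x) - SS i k (XX ρ₀ vt t x))) := by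
      simp only [g', HH, Fin.sum_univ_two]; ring
    rw [eL]
    refine hp2.trans ?_
    have eR : C * g t x = C * (ρ₀ x * ∑ i, (UU v i (t, x) - UU vt i (t, x)) ^ 2) +
      ρ₀ x * (C * ∑ i, ∑ k, (AA v i k t x - AA vt i k t x) ^ 2) := by
      simp only [g]; ring
    rw [eR]
    linarith
  let Φ : ℝ → ℝ := fun s => ∫ x in Sq, g s x
  have hΦ0 : Φ 0 = 0 := by
    have e : ∀ x ∈ Sq, g 0 x = 0 := by
      intro x hx
      rw [Sq_eq_closure] at hx
      refine closure_minimal (s := Oset) (t := {x | g 0 x = 0}) (fun y hy => ?_)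
        (isClosed_eq (hgs 0) continuous_const) hx
      simp [g, UU, AA, h0 y hy]
    simp only [Φ]
    rw [setIntegral_congr_fun Sq_compact.measurableSet e]; simp
  have hanti : AntitoneOn (fun s => Real.exp (-C * s) * Φ s) (Set.Icc 0 T) := by
    have hd : ∀ s, HasDerivAt (fun s => Real.exp (-C * s) * Φ s)
        (Real.exp (-C * s) * (-C * 1) * Φ s + Real.exp (-C * s) * ∫ x in Sq, g' s x) s :=
      fun s => (((hasDerivAt_id s).const_mul (-C)).exp).mul (hΦd s)
    refine antitoneOn_of_deriv_nonpos (convex_Icc 0 T)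
      (fun s _ => (hd s).continuousAt.continuousWithinAt)
      (fun s _ => (hd s).differentiableAt.differentiableWithinAt) ?_
    intro s hs
    rw [interior_Icc] at hs
    rw [(hd s).deriv]
    have h1 : ∫ x in Sq, g' s x ≤ C * Φ s := hineq s hs.1 hs.2.le
    have h2 := mul_le_mul_of_nonneg_left h1 (Real.exp_pos (-C * s)).le
    linarith
  intro t h0t htT x hx
  have hΦt : Φ t = 0 := by
    have h1 := hanti ⟨le_rfl, hTpos.le⟩ ⟨h0t.le, htT⟩ h0t.le
    simp only [hΦ0, mul_zero] at h1
    have h2 : Φ t ≤ 0 := by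
      by_contra hcon
      have := mul_pos (Real.exp_pos (-C * t)) (not_le.1 hcon)
      linarith
    exact le_antisymm h2 (setIntegral_nonneg Sq_compact.measurableSet (hgnn t))
  have hae : g t =ᵐ[volume.restrict Sq] 0 := by
    refine (integral_eq_zero_iff_of_nonneg_ae ?_ (hgi t)).1 hΦt
    exact (ae_restrict_iff' Sq_compact.measurableSet).2 (Eventually.of_forall (hgnn t))
  rw [← Measure.restrict_congr_set Sq_ae] at hae
  have hzero : g t x = 0 := Measure.eqOn_open_of_ae_eq hae Oset_open (hgs t).continuousOn
    continuousOn_const hx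
  have hsum : ∑ i, (UU v i (t, x) - UU vt i (t, x)) ^ 2 +
      ∑ i, ∑ k, (AA v i k t x - AA vt i k t x) ^ 2 = 0 :=
    (mul_eq_zero.1 hzero).resolve_left (hρnn x hx).ne'
  have hs1 : ∑ i, (UU v i (t, x) - UU vt i (t, x)) ^ 2 = 0 := by
    have a1 : 0 ≤ ∑ i, (UU v i (t, x) - UU vt i (t, x)) ^ 2 := by positivity
    have a2 : 0 ≤ ∑ i, ∑ k, (AA v i k t x - AA vt i k t x) ^ 2 := by positivity
    linarith
  have hs2 : ∀ i, UU v i (t, x) = UU vt i (t, x) := by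
    intro i
    have := (Finset.sum_eq_zero_iff_of_nonneg (fun i _ => by positivity)).1 hs1 i
      (Finset.mem_univ i)
    exact sub_eq_zero.1 (pow_eq_zero_iff (two_ne_zero)|>.1 this)
  have q0 := hs2 0
  have q1 := hs2 1
  simp [UU, pick] at q0 q1
  exact Prod.ext q0 q1
end
end

section
/- Automatic Neumann-type boundary condition: let v be a classical solution of the Lagrangian system ρ₀∂_t v^i + (ρ₀²J^{−2}a_i^k),_k = (ρ₀J^{−2}b^{kj}v^i,_j),_k on Ω×(0,T], smooth up to the boundary on Ω̄×[0,T] (so that v, Dv, D²v, ∂_t v, Dη, D²η extend continuously to Ω̄) and satisfying the a priori assumption. Then for every t ∈ (0,T] and every x ∈ Γ, the boundary condition (ρ₀),_k(x) a_l^k(x,t) a_l^j(x,t) v^i,_j(x,t) = 0 holds for i = 1, 2, i.e. (ρ₀),_k b^{kj} v^i,_j = 0 on Γ×(0,T]. -/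
open MeasureTheory Real Filter

noncomputable section

variable {F : Type*} [NormedAddCommGroup F] [NormedSpace ℝ F]

/-- Differentiation under the integral sign for a jointly `C¹` integrand. -/
theorem par_hasFDerivAt {G : Type} [NormedAddCommGroup G] [NormedSpace ℝ G] [CompleteSpace G]
    (w : ℝ → ℝ × ℝ → G) (hw : ContDiff ℝ 1 (Function.uncurry w)) (t : ℝ) (x : ℝ × ℝ) :
    HasFDerivAt (fun y => ∫ s in (0:ℝ)..t, w s y) (∫ s in (0:ℝ)..t, fderiv ℝ (w s) x) x := by
  have hD : Continuous (fun p : ℝ × (ℝ × ℝ) => fderiv ℝ (w p.1) p.2) := by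
    have h0 : ContDiff ℝ 1 (Function.uncurry (fun p : ℝ × (ℝ × ℝ) => w p.1)) := by
      have : Function.uncurry (fun p : ℝ × (ℝ × ℝ) => w p.1)
          = Function.uncurry w ∘ (fun q : (ℝ × (ℝ × ℝ)) × (ℝ × ℝ) => (q.1.1, q.2)) := by
        ext q; rfl
      rw [this]
      exact hw.comp (by fun_prop)
    exact (ContDiff.fderiv (n := 0) h0 contDiff_snd (by norm_num)).continuous
  have hwc : Continuous (Function.uncurry w) := hw.continuous
  have hK : IsCompact (Set.uIcc (0:ℝ) t ×ˢ Metric.closedBall x 1) :=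
    isCompact_uIcc.prod (isCompact_closedBall x 1)
  obtain ⟨C, hC⟩ := hK.exists_bound_of_continuousOn hD.continuousOn
  refine intervalIntegral.hasFDerivAt_integral_of_dominated_of_fderiv_le
    (F := fun y s => w s y) (F' := fun y s => fderiv ℝ (w s) y)
    (s := Metric.closedBall x 1) (bound := fun _ => C) (Metric.closedBall_mem_nhds x one_pos)
    ?_ ?_ ?_ ?_ ?_ ?_
  · refine Filter.Eventually.of_forall fun y => Continuous.aestronglyMeasurable ?_
    exact hwc.comp (by fun_prop : Continuous fun s : ℝ => (s, y))
  · exact (hwc.comp (by fun_prop : Continuous fun s : ℝ => (s, x))).intervalIntegrable _ _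
  · exact Continuous.aestronglyMeasurable
      (hD.comp (by fun_prop : Continuous fun s : ℝ => (s, x)))
  · refine Filter.Eventually.of_forall fun s hs y hy => hC (s, y) ⟨?_, hy⟩
    exact Set.uIoc_subset_uIcc hs
  · exact continuous_const.intervalIntegrable _ _
  · refine Filter.Eventually.of_forall fun s hs y hy => ?_
    have : ContDiff ℝ 1 (w s) :=
      hw.comp (by fun_prop : ContDiff ℝ 1 fun y : ℝ × ℝ => (s, y))
    exact (this.differentiable (by norm_num) y).hasFDerivAt

/-- Parametric integrals of smooth functions are smooth. -/
theorem par_contDiff (n : ℕ) : ∀ {G : Type} [NormedAddCommGroup G] [NormedSpace ℝ G]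
    [CompleteSpace G] (w : ℝ → ℝ × ℝ → G)
    (_ : ∀ m : ℕ, ContDiff ℝ m (Function.uncurry w)) (t : ℝ),
    ContDiff ℝ n (fun y => ∫ s in (0:ℝ)..t, w s y) := by
  induction n with
  | zero =>
    intro G _ _ _ w hw t
    refine contDiff_zero.2 ?_
    exact intervalIntegral.continuous_parametric_intervalIntegral_of_continuous'
      (f := fun y s => w s y)
      ((hw 0).continuous.comp (by fun_prop : Continuous fun p : (ℝ × ℝ) × ℝ => (p.2, p.1))) 0 t
  | succ n ih =>
    intro G _ _ _ w hw t
    have h1 : ∀ x, HasFDerivAt (fun y => ∫ s in (0:ℝ)..t, w s y)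
        (∫ s in (0:ℝ)..t, fderiv ℝ (w s) x) x :=
      fun x => par_hasFDerivAt w (by exact_mod_cast hw 1) t x
    have h2 : fderiv ℝ (fun y => ∫ s in (0:ℝ)..t, w s y)
        = fun x => ∫ s in (0:ℝ)..t, fderiv ℝ (w s) x := funext fun x => (h1 x).fderiv
    push_cast
    refine contDiff_succ_iff_fderiv.2 ⟨fun x => (h1 x).differentiableAt, by simp, ?_⟩
    rw [h2]
    refine ih (fun s x => fderiv ℝ (w s) x) (fun m => ?_) t
    have h0 : ContDiff ℝ (m + 1 : ℕ) (Function.uncurry (fun p : ℝ × (ℝ × ℝ) => w p.1)) := by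
      have : Function.uncurry (fun p : ℝ × (ℝ × ℝ) => w p.1)
          = Function.uncurry w ∘ (fun q : (ℝ × (ℝ × ℝ)) × (ℝ × ℝ) => (q.1.1, q.2)) := by
        ext q; rfl
      rw [this]
      exact (hw (m+1)).comp (by fun_prop)
    exact ContDiff.fderiv (n := m) h0 contDiff_snd (by push_cast; exact le_rfl)

theorem flow_contDiff (v : ℝ → ℝ × ℝ → ℝ × ℝ) (hv : SmoothT v) (t : ℝ) (n : ℕ) :
    ContDiff ℝ n (flowMap v t) := by
  unfold flowMap
  exact contDiff_id.add (par_contDiff n v hv t)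

theorem flow_hasFDerivAt (v : ℝ → ℝ × ℝ → ℝ × ℝ) (hv : SmoothT v) (t : ℝ) (x : ℝ × ℝ) :
    HasFDerivAt (flowMap v t)
      (ContinuousLinearMap.id ℝ (ℝ × ℝ) + ∫ s in (0:ℝ)..t, fderiv ℝ (v s) x) x := by
  unfold flowMap
  exact (hasFDerivAt_id x).add (par_hasFDerivAt v (by exact_mod_cast hv 1) t x)

theorem fderiv_shift {G : Type} [NormedAddCommGroup G] [NormedSpace ℝ G]
    (f : ℝ × ℝ → G) (c : G) (hf : ∀ x : ℝ × ℝ, f (x + (1, 0)) = f x + c) (x : ℝ × ℝ) :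
    fderiv ℝ f (x + (1, 0)) = fderiv ℝ f x := by
  rw [← fderiv_comp_add_right, show (fun y => f (y + (1, 0))) = fun y => f y + c from funext hf,
    fderiv_add_const]

theorem flow_shift (v : ℝ → ℝ × ℝ → ℝ × ℝ) (hper : PerT v) (t : ℝ) (x : ℝ × ℝ) :
    flowMap v t (x + (1, 0)) = flowMap v t x + (1, 0) := by
  unfold flowMap
  have : ∀ s, v s (x + (1, 0)) = v s x := fun s => by
    have := hper s x
    rw [← this]; congr 1; ext <;> simp
  simp only [this]
  abel

theorem cof_shift (η : ℝ × ℝ → ℝ × ℝ) (h : ∀ x, η (x + (1, 0)) = η x + (1, 0)) (x : ℝ × ℝ)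
    (i k : Fin 2) : cof η (x + (1, 0)) i k = cof η x i k := by
  unfold cof pd1 pd2
  rw [fderiv_shift (fun y => (η y).1) 1 (fun x => by simp [h]),
    fderiv_shift (fun y => (η y).2) 0 (fun x => by simp [h])]

theorem contDiff_dir (f : ℝ × ℝ → ℝ) (hf : ContDiff ℝ 2 f) (e : ℝ × ℝ) :
    ContDiff ℝ 1 (fun x => fderiv ℝ f x e) :=
  (hf.fderiv_right (m := 1) (by norm_num)).clm_apply contDiff_const

theorem cof_contDiff (η : ℝ × ℝ → ℝ × ℝ) (h : ContDiff ℝ 2 η) (i k : Fin 2) :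
    ContDiff ℝ 1 (fun x => cof η x i k) := by
  have h1 := contDiff_dir _ h.fst
  have h2 := contDiff_dir _ h.snd
  unfold cof pd1 pd2
  split_ifs
  · exact h2 _
  · exact (h2 _).neg
  · exact (h1 _).neg
  · exact h1 _

theorem jac_contDiff (η : ℝ × ℝ → ℝ × ℝ) (h : ContDiff ℝ 2 η) :
    ContDiff ℝ 1 (fun x => jac η x) := by
  have h1 := contDiff_dir _ h.fst
  have h2 := contDiff_dir _ h.snd
  unfold jac pd1 pd2
  exact ((h1 _).mul (h2 _)).sub ((h1 _).mul (h2 _))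

theorem bmat_contDiff (η : ℝ × ℝ → ℝ × ℝ) (h : ContDiff ℝ 2 η) (k j : Fin 2) :
    ContDiff ℝ 1 (fun x => bmat η x k j) := by
  unfold bmat
  exact ContDiff.sum fun l _ => (cof_contDiff η h l k).mul (cof_contDiff η h l j)

theorem pick_contDiff (i : Fin 2) (n : ℕ) (f : ℝ × ℝ → ℝ × ℝ) (h : ContDiff ℝ n f) :
    ContDiff ℝ n (fun x => pick i (f x)) := by
  unfold pick
  split_ifs
  · exact h.fst
  · exact h.snd

/-- The a priori assumption bounds `Dv` on the closed square. -/
theorem apriori_bound (ρ₀ : ℝ × ℝ → ℝ) (v : ℝ → ℝ × ℝ → ℝ × ℝ) (hv : SmoothT v)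
    (T M₁ c₁ c₂ : ℝ) (hap : Apriori ρ₀ v T M₁ c₁ c₂) (s : ℝ) (hs : s ∈ Set.Icc 0 T)
    (x : ℝ × ℝ) (hx : x ∈ closure Oset) :
    ‖fderiv ℝ (v s) x‖ ≤ c₁ * c₂ * Real.sqrt M₁ := by
  obtain ⟨hc1, hc2, hM, hT, hT1, hT2, hE, hb⟩ := hap
  have hvs : ContDiff ℝ (1:ℕ) (v s) :=
    (hv 1).comp (by fun_prop : ContDiff ℝ (1:ℕ) fun y : ℝ × ℝ => (s, y))
  have hcont : Continuous (fun y => ‖fderiv ℝ (v s) y‖) :=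
    (hvs.continuous_fderiv (by norm_num)).norm
  refine closure_minimal (t := {y | ‖fderiv ℝ (v s) y‖ ≤ c₁ * c₂ * Real.sqrt M₁}) ?_
    (isClosed_le hcont continuous_const) hx
  intro y hy
  refine (hb s hs y hy).trans ?_
  have := Real.sqrt_le_sqrt (hE s hs)
  gcongr

theorem jac_ne (ρ₀ : ℝ × ℝ → ℝ) (v : ℝ → ℝ × ℝ → ℝ × ℝ) (hv : SmoothT v)
    (T M₁ c₁ c₂ : ℝ) (hap : Apriori ρ₀ v T M₁ c₁ c₂) (t : ℝ) (ht : 0 < t) (htT : t ≤ T)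
    (x : ℝ × ℝ) (hx : x ∈ closure Oset) : jac (flowMap v t) x ≠ 0 := by
  have hb := apriori_bound ρ₀ v hv T M₁ c₁ c₂ hap
  obtain ⟨hc1, hc2, hM, hT, hT1, hT2, -, -⟩ := hap
  set K := c₁ * c₂ * Real.sqrt M₁ with hK
  have hK0 : 0 ≤ K := by positivity
  have hKT : K * t ≤ 1 / 20 := by
    have hden : 20 * c₁ * c₂ * Real.sqrt M₁ + 10 * c₁ ^ 2 * c₂ ^ 2 * M₁ = 20 * K + 10 * K ^ 2 := by
      rw [hK, mul_pow, mul_pow, Real.sq_sqrt hM]; ring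
    rw [hden] at hT2
    rcases hK0.eq_or_lt with h0 | h0
    · rw [← h0]; norm_num
    · rw [le_div_iff₀ (by positivity)] at hT2
      nlinarith [mul_le_mul_of_nonneg_left htT hK0, mul_nonneg hT.le (sq_nonneg K)]
  set L : ℝ × ℝ →L[ℝ] ℝ × ℝ := ∫ s in (0:ℝ)..t, fderiv ℝ (v s) x with hL
  have hLn : ‖L‖ ≤ 1 / 20 := by
    refine (intervalIntegral.norm_integral_le_of_norm_le_const (C := K) ?_).trans ?_
    · intro s hs
      rw [Set.uIoc_of_le ht.le] at hs
      exact hb s ⟨hs.1.le, hs.2.trans htT⟩ x hx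
    · rw [sub_zero, abs_of_pos ht]; exact hKT
  have hη := flow_hasFDerivAt v hv t x
  have e1 : ∀ e, fderiv ℝ (fun y => (flowMap v t y).1) x e = e.1 + (L e).1 := fun e => by
    rw [hη.fst.fderiv]; simp [hL]
  have e2 : ∀ e, fderiv ℝ (fun y => (flowMap v t y).2) x e = e.2 + (L e).2 := fun e => by
    rw [hη.snd.fderiv]; simp [hL]
  have hbd : ∀ e : ℝ × ℝ, ‖e‖ ≤ 1 → |(L e).1| ≤ 1 / 20 ∧ |(L e).2| ≤ 1 / 20 := fun e he => by
    have h1 : ‖L e‖ ≤ 1 / 20 := by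
      refine (L.le_opNorm e).trans ?_
      nlinarith [norm_nonneg L, norm_nonneg e]
    exact ⟨(norm_fst_le (L e)).trans h1, (norm_snd_le (L e)).trans h1⟩
  obtain ⟨a1, a2⟩ := hbd (1, 0) (by simp [Prod.norm_def])
  obtain ⟨a3, a4⟩ := hbd (0, 1) (by simp [Prod.norm_def])
  unfold jac pd1 pd2
  simp only [e1, e2]
  rw [abs_le] at a1 a2 a3 a4
  apply ne_of_gt
  generalize (L (1, 0)).1 = p at *
  generalize (L (1, 0)).2 = q at *
  generalize (L (0, 1)).1 = r at *
  generalize (L (0, 1)).2 = u at *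
  have h1 : r * q ≤ 1 / 400 := by nlinarith
  have h2 : (19 / 20 : ℝ) * (19 / 20) ≤ (1 + p) * (1 + u) := by nlinarith
  nlinarith

/-- The boundary condition on the part of `Γ` in the closed fundamental square. -/
theorem stmt19_aux (C₁ C₂ : ℝ) (ρ₀ : ℝ × ℝ → ℝ) (hρ : IsDensity C₁ C₂ ρ₀)
    (T : ℝ) (v : ℝ → ℝ × ℝ → ℝ × ℝ) (hv : SmoothT v)
    (hsol : IsLagSol ρ₀ v T)
    (M₁ c₁ c₂ : ℝ) (hap : Apriori ρ₀ v T M₁ c₁ c₂)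
    (t : ℝ) (ht : 0 < t) (htT : t ≤ T) (x : ℝ × ℝ) (hxG : x ∈ Gset) (hx : x ∈ closure Oset)
    (i : Fin 2) :
      ∑ k : Fin 2, ∑ j : Fin 2,
        pdk k ρ₀ x * bmat (flowMap v t) x k j * pdk j (fun z => pick i (v t z)) x = 0 := by
  have hJ := jac_ne ρ₀ v hv T M₁ c₁ c₂ hap t ht htT x hx
  have hη : ContDiff ℝ 2 (flowMap v t) := by exact_mod_cast flow_contDiff v hv t 2
  have hvt : ContDiff ℝ (2:ℕ) (v t) :=
    (hv 2).comp (by fun_prop : ContDiff ℝ (2:ℕ) fun y : ℝ × ℝ => (t, y))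
  have hρ1 : ContDiff ℝ 1 ρ₀ := by exact_mod_cast hρ.1 1
  have hρ0 : ρ₀ x = 0 := hρ.2.2.1 x hxG
  have hJi : ContDiffAt ℝ 1 (fun y => jac (flowMap v t) y ^ (-2 : ℤ)) x := by
    have : (fun y => jac (flowMap v t) y ^ (-2 : ℤ)) = fun y => (jac (flowMap v t) y ^ 2)⁻¹ := by
      ext y; rw [zpow_neg]; norm_cast
    rw [this]
    exact ((jac_contDiff _ hη).contDiffAt.pow 2).inv (pow_ne_zero 2 hJ)
  set P : Fin 2 → ℝ × ℝ → ℝ := fun k y =>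
    ρ₀ y * jac (flowMap v t) y ^ (-2 : ℤ) * cof (flowMap v t) y i k with hP
  set Q : Fin 2 → ℝ × ℝ → ℝ := fun k y => jac (flowMap v t) y ^ (-2 : ℤ) *
    ∑ j : Fin 2, bmat (flowMap v t) y k j * pdk j (fun z => pick i (v t z)) y with hQ
  have hPc : ∀ k, ContDiffAt ℝ 1 (P k) x := fun k =>
    (hρ1.contDiffAt.mul hJi).mul (cof_contDiff _ hη i k).contDiffAt
  have hQc : ∀ k, ContDiffAt ℝ 1 (Q k) x := fun k => by
    refine hJi.mul (ContDiff.contDiffAt ?_)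
    refine ContDiff.sum fun j _ => (bmat_contDiff _ hη k j).mul ?_
    exact contDiff_dir _ (by exact_mod_cast pick_contDiff i 2 (v t) hvt) _
  have hcont : ∀ (f : ℝ × ℝ → ℝ), ContDiffAt ℝ 1 f x → ∀ k, ContinuousAt (pdk k f) x :=
    fun f hf k => by
      have : ContDiffAt ℝ 0 (fderiv ℝ f) x := hf.fderiv_right (by norm_num)
      exact this.continuousAt.clm_apply continuousAt_const
  have hdt : Continuous (fun y => pick i (pdt v t y)) := by
    have h1 : ContDiff ℝ (0:ℕ) (fun y => pdt v t y) := by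
      have : (fun y => pdt v t y) = fun y => fderiv ℝ
          (fun p : ℝ × (ℝ × ℝ) => v p.1 p.2) (t, y) (1, 0) := by
        ext1 y
        have hd : HasFDerivAt (fun p : ℝ × (ℝ × ℝ) => v p.1 p.2) _ (t, y) :=
          (((hv 1).differentiable (by norm_num)) (t, y)).hasFDerivAt
        have hl : HasDerivAt (fun s : ℝ => (s, y)) ((1 : ℝ), (0 : ℝ × ℝ)) t :=
          (hasDerivAt_id t).prodMk (hasDerivAt_const t y)
        exact (hd.comp_hasDerivAt t hl).deriv
      rw [this]
      have h2 : ContDiff ℝ (0:ℕ) (fderiv ℝ (fun p : ℝ × (ℝ × ℝ) => v p.1 p.2)) :=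
        (hv 1).fderiv_right (by norm_num)
      exact (h2.comp (by fun_prop : ContDiff ℝ (0:ℕ) fun y : ℝ × ℝ => (t, y))).clm_apply
        contDiff_const
    exact (pick_contDiff i 0 _ h1).continuous
  -- rewrite the equation
  have heq : ∀ y ∈ Oset, ρ₀ y * pick i (pdt v t y) + ∑ k : Fin 2, pdk k (fun z => ρ₀ z * P k z) y
      = ∑ k : Fin 2, pdk k (fun z => ρ₀ z * Q k z) y := by
    intro y hy
    have := hsol t ht htT y hy i
    have e1 : ∀ k, (fun z => ρ₀ z * P k z) = (fun y => ρ₀ y ^ 2 *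
        jac (flowMap v t) y ^ (-2 : ℤ) * cof (flowMap v t) y i k) := fun k => by
      ext z; simp only [hP]; ring
    have e2 : ∀ k, (fun z => ρ₀ z * Q k z) = (fun y => ρ₀ y * jac (flowMap v t) y ^ (-2 : ℤ) *
            ∑ j : Fin 2, bmat (flowMap v t) y k j * pdk j (fun z => pick i (v t z)) y) :=
      fun k => by
        ext z; simp only [hQ]; ring
    simp only [e1, e2]
    exact this
  have hlim : ρ₀ x * pick i (pdt v t x) + ∑ k : Fin 2, pdk k (fun z => ρ₀ z * P k z) x
      = ∑ k : Fin 2, pdk k (fun z => ρ₀ z * Q k z) x := by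
    have : (nhdsWithin x Oset).NeBot := mem_closure_iff_nhdsWithin_neBot.1 hx
    have hl : ContinuousAt (fun y => ρ₀ y * pick i (pdt v t y)
        + ∑ k : Fin 2, pdk k (fun z => ρ₀ z * P k z) y) x :=
      (hρ1.continuous.continuousAt.mul hdt.continuousAt).add
        (tendsto_finsetSum _ fun k _ => hcont _ (hρ1.contDiffAt.mul (hPc k)) k)
    have hr : ContinuousAt (fun y => ∑ k : Fin 2, pdk k (fun z => ρ₀ z * Q k z) y) x :=
      tendsto_finsetSum _ fun k _ => hcont _ (hρ1.contDiffAt.mul (hQc k)) k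
    refine tendsto_nhds_unique (f := fun y => ρ₀ y * pick i (pdt v t y)
        + ∑ k : Fin 2, pdk k (fun z => ρ₀ z * P k z) y) (l := nhdsWithin x Oset)
      (hl.tendsto.mono_left nhdsWithin_le_nhds) ?_
    refine (hr.tendsto.mono_left nhdsWithin_le_nhds).congr' ?_
    filter_upwards [self_mem_nhdsWithin] with y hy
    exact (heq y hy).symm
  have hprod : ∀ f : ℝ × ℝ → ℝ, ContDiffAt ℝ 1 f x → ∀ k,
      pdk k (fun z => ρ₀ z * f z) x = pdk k ρ₀ x * f x := fun f hf k => by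
    have h1 := (hρ1.differentiable (by norm_num) x).hasFDerivAt
    have h2 := (hf.differentiableAt (by norm_num)).hasFDerivAt
    unfold pdk
    rw [show (fun z => ρ₀ z * f z) = ρ₀ * f from rfl, (h1.mul h2).fderiv]
    simp [hρ0, mul_comm]
  have hP0 : ∀ k, P k x = 0 := fun k => by simp [hP, hρ0]
  simp only [hprod _ (hPc _), hprod _ (hQc _), hP0, hρ0] at hlim
  simp only [zero_mul, mul_zero, Finset.sum_const_zero, add_zero, hQ] at hlim
  have hJz : jac (flowMap v t) x ^ (-2 : ℤ) ≠ 0 := zpow_ne_zero _ hJ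
  refine (mul_eq_zero.1 (Eq.trans ?_ hlim.symm)).resolve_left hJz
  simp only [Finset.mul_sum]
  refine Finset.sum_congr rfl fun k _ => Finset.sum_congr rfl fun j _ => by ring

/-- (Automatic Neumann-type boundary condition, (2.8) in Theorem 2.1.)
A classical solution of the Lagrangian system, smooth up to the boundary and satisfying
the a priori assumption, automatically satisfies
`(ρ₀),_k a_l^k a_l^j v^i,_j = (ρ₀),_k b^{kj} v^i,_j = 0` on `Γ × (0,T]`. -/
theorem stmt19 (C₁ C₂ : ℝ) (hC₁ : 0 < C₁) (hC₁₂ : C₁ ≤ C₂)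
    (ρ₀ : ℝ × ℝ → ℝ) (hρ : IsDensity C₁ C₂ ρ₀)
    (T : ℝ) (v : ℝ → ℝ × ℝ → ℝ × ℝ) (hv : SmoothT v) (hvper : PerT v)
    (hsol : IsLagSol ρ₀ v T)
    (M₁ c₁ c₂ : ℝ) (hap : Apriori ρ₀ v T M₁ c₁ c₂) :
    ∀ t : ℝ, 0 < t → t ≤ T → ∀ x ∈ Gset, ∀ i : Fin 2,
      ∑ k : Fin 2, ∑ j : Fin 2,
        pdk k ρ₀ x * bmat (flowMap v t) x k j * pdk j (fun z => pick i (v t z)) x = 0 := by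
  intro t ht htT x hx i
  set Q : ℝ × ℝ → ℝ := fun x => ∑ k : Fin 2, ∑ j : Fin 2,
        pdk k ρ₀ x * bmat (flowMap v t) x k j * pdk j (fun z => pick i (v t z)) x with hQ
  have hshift : ∀ (y : ℝ × ℝ), y + (1, 0) = (y.1 + 1, y.2) := fun y => by ext <;> simp
  have hper : ∀ y, Q (y + (1, 0)) = Q y := fun y => by
    have h1 : ∀ k, pdk k ρ₀ (y + (1, 0)) = pdk k ρ₀ y := fun k => by
      unfold pdk
      rw [fderiv_shift ρ₀ 0 (fun z => by rw [hshift, hρ.2.1 z, add_zero])]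
    have h2 : ∀ j, pdk j (fun z => pick i (v t z)) (y + (1, 0))
        = pdk j (fun z => pick i (v t z)) y := fun j => by
      unfold pdk
      rw [fderiv_shift (fun z => pick i (v t z)) 0
        (fun z => by rw [hshift, hvper t z, add_zero])]
    simp only [hQ, bmat, h1, h2, cof_shift _ (flow_shift v hvper t)]
  have hp1 : Function.Periodic (fun a : ℝ => Q (a, x.2)) 1 := fun a => by
    have := hper (a, x.2)
    rwa [hshift] at this
  obtain ⟨b, hb, hbe⟩ := hp1.exists_mem_Ico₀ one_pos x.1
  change Q x = 0
  have hbe' : Q x = Q (b, x.2) := hbe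
  rw [hbe']
  refine stmt19_aux C₁ C₂ ρ₀ hρ T v hv hsol M₁ c₁ c₂ hap t ht htT (b, x.2) hx ?_ i
  rw [Oset, closure_prod_eq, closure_Ioo zero_ne_one]
  refine ⟨⟨hb.1, hb.2.le⟩, ?_⟩
  rcases hx with h | h <;> simp [h]
end
end
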